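/- arXiv:math/0607503 — 2 statements merged into one kernel-verified Lean document; each statement's English description precedes it below -/
import Mathlib

section
/- Let n ≥ 3, let Ω be an open domain in ℂⁿ, and let f : Ω → ℙ^m be a map into complex projective m-space. If for every coordinate 2-plane Π² in ℂⁿ the restriction of f to Ω ∩ Π² is holomorphic, then f is holomorphic on Ω. -/
/-- A coordinate `k`-plane in `ℂⁿ`: the affine subspace obtained by fixing `n - k`
of the coordinates at constant values. -/
def IsCoordPlane (n k : ℕ) (P : Set (Fin n → ℂ)) : Prop :=
  ∃ (I : Finset (Fin n)) (c : Fin n → ℂ), I.card = n - k ∧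
    P = {z | ∀ i ∈ I, z i = c i}

/-- A map `f` from a subset `S` of a complex normed space to the complex projective
space `ℙ^m` is holomorphic on `S` if every point of `S` has an open neighbourhood `U`
and a holomorphic map `F : U → ℂ^{m+1} \ {0}` such that `f z = [F z]` for all
`z ∈ U ∩ S`. -/
def IsHolomorphicOnP {E : Type} [NormedAddCommGroup E] [NormedSpace ℂ E] {m : ℕ}
    (S : Set E) (f : E → Projectivization ℂ (Fin (m + 1) → ℂ)) : Prop :=
  ∀ z ∈ S, ∃ U : Set E, IsOpen U ∧ z ∈ U ∧
    ∃ (F : E → (Fin (m + 1) → ℂ)) (hF : ∀ w ∈ U, F w ≠ 0),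
      DifferentiableOn ℂ F U ∧
      ∀ w (hw : w ∈ U), w ∈ S → f w = Projectivization.mk ℂ (F w) (hF w hw)

open Metric Set Filter Topology MeasureTheory Real

section Charts

variable {m : ℕ}

/-- The `j`-th affine coordinates `z l / z j` of a point of projective space. -/
noncomputable def projRatio (j : Fin (m + 1)) (q : Projectivization ℂ (Fin (m + 1) → ℂ)) :
    Fin (m + 1) → ℂ :=
  fun l => q.rep l / q.rep j

/-- The point `q` lies in the `j`-th affine chart and has affine coordinates of norm
at most `M` there. -/
def ChartBounded (j : Fin (m + 1)) (M : ℝ) (q : Projectivization ℂ (Fin (m + 1) → ℂ)) : Prop :=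
  ∀ l, ‖q.rep l‖ ≤ M * ‖q.rep j‖

theorem projRatio_mk (j : Fin (m + 1)) (v : Fin (m + 1) → ℂ) (hv : v ≠ 0) :
    projRatio j (Projectivization.mk ℂ v hv) = fun l => v l / v j := by
  obtain ⟨a, ha⟩ := Projectivization.exists_smul_eq_mk_rep ℂ v hv
  funext l
  rw [projRatio, ← ha]
  simp only [Pi.smul_apply, Units.smul_def, smul_eq_mul]
  exact mul_div_mul_left _ _ a.ne_zero

theorem chartBounded_mk {j : Fin (m + 1)} {M : ℝ} {v : Fin (m + 1) → ℂ} {hv : v ≠ 0} :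
    ChartBounded j M (Projectivization.mk ℂ v hv) ↔ ∀ l, ‖v l‖ ≤ M * ‖v j‖ := by
  obtain ⟨a, ha⟩ := Projectivization.exists_smul_eq_mk_rep ℂ v hv
  have h0 : 0 < ‖(a : ℂ)‖ := norm_pos_iff.2 a.ne_zero
  refine forall_congr' fun l => ?_
  rw [← ha]
  simp only [Pi.smul_apply, Units.smul_def, smul_eq_mul, norm_mul]
  rw [mul_left_comm, mul_le_mul_iff_right₀ h0]

theorem ChartBounded.rep_ne_zero {j : Fin (m + 1)} {M : ℝ}
    {q : Projectivization ℂ (Fin (m + 1) → ℂ)} (h : ChartBounded j M q) : q.rep j ≠ 0 := by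
  intro h0
  refine q.rep_nonzero (funext fun l => ?_)
  simpa [h0] using h l

theorem ChartBounded.norm_projRatio_le {j : Fin (m + 1)} {M : ℝ}
    {q : Projectivization ℂ (Fin (m + 1) → ℂ)} (h : ChartBounded j M q) (l : Fin (m + 1)) :
    ‖projRatio j q l‖ ≤ M := by
  rw [projRatio, norm_div, div_le_iff₀ (norm_pos_iff.2 h.rep_ne_zero)]
  exact h l

theorem ChartBounded.one_le {j : Fin (m + 1)} {M : ℝ}
    {q : Projectivization ℂ (Fin (m + 1) → ℂ)} (h : ChartBounded j M q) : 1 ≤ M :=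
  le_of_mul_le_mul_right (by simpa using h j) (norm_pos_iff.2 h.rep_ne_zero)

theorem exists_chartBounded (q : Projectivization ℂ (Fin (m + 1) → ℂ)) :
    ∃ j, ChartBounded j 1 q := by
  obtain ⟨j, hj⟩ := Finite.exists_max fun l => ‖q.rep l‖
  exact ⟨j, fun l => by simpa using hj l⟩

theorem projRatio_ne_zero {j : Fin (m + 1)} {q : Projectivization ℂ (Fin (m + 1) → ℂ)}
    (h : q.rep j ≠ 0) : projRatio j q ≠ 0 := fun h0 => by
  simpa [projRatio, h] using congrFun h0 j

theorem mk_projRatio {j : Fin (m + 1)} {q : Projectivization ℂ (Fin (m + 1) → ℂ)}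
    (h : q.rep j ≠ 0) :
    Projectivization.mk ℂ (projRatio j q) (projRatio_ne_zero h) = q := by
  conv_rhs => rw [← q.mk_rep]
  rw [Projectivization.mk_eq_mk_iff']
  refine ⟨(q.rep j)⁻¹, funext fun l => ?_⟩
  simp [projRatio, div_eq_inv_mul]

end Charts

section Holomorphic

variable {m : ℕ} {E E' : Type} [NormedAddCommGroup E] [NormedSpace ℂ E]
  [NormedAddCommGroup E'] [NormedSpace ℂ E']
  {f : E → Projectivization ℂ (Fin (m + 1) → ℂ)} {S : Set E}

theorem IsHolomorphicOnP.comp (hf : IsHolomorphicOnP S f) {φ : E' → E}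
    (hφ : Differentiable ℂ φ) {S' : Set E'} (hS : MapsTo φ S' S) :
    IsHolomorphicOnP S' (f ∘ φ) := by
  intro z hz
  obtain ⟨U, hU, hzU, F, hF, hd, he⟩ := hf (φ z) (hS hz)
  exact ⟨φ ⁻¹' U, hU.preimage hφ.continuous, hzU, F ∘ φ, fun w hw => hF _ hw,
    hd.comp hφ.differentiableOn fun w hw => hw, fun w hw hwS => he _ hw (hS hwS)⟩

theorem IsHolomorphicOnP.exists_lift (hf : IsHolomorphicOnP S f) (hS : IsOpen S) {p : E}
    (hp : p ∈ S) : ∃ δ > 0, ball p δ ⊆ S ∧ ∃ F : E → Fin (m + 1) → ℂ,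
      ∃ hF : ∀ w ∈ ball p δ, F w ≠ 0, DifferentiableOn ℂ F (ball p δ) ∧
        ∀ w (hw : w ∈ ball p δ), f w = Projectivization.mk ℂ (F w) (hF w hw) := by
  obtain ⟨U, hU, hzU, F, hF, hd, he⟩ := hf p hp
  obtain ⟨δ, hδ, hsub⟩ := Metric.isOpen_iff.1 (hU.inter hS) p ⟨hzU, hp⟩
  exact ⟨δ, hδ, fun w hw => (hsub hw).2, F, fun w hw => hF w (hsub hw).1,
    hd.mono fun w hw => (hsub hw).1, fun w hw => he w (hsub hw).1 (hsub hw).2⟩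

theorem IsHolomorphicOnP.eventually_chartBounded (hf : IsHolomorphicOnP S f) (hS : IsOpen S)
    {p : E} (hp : p ∈ S) {j : Fin (m + 1)} {M M' : ℝ} (hM : ChartBounded j M (f p))
    (hMM' : M < M') : ∀ᶠ z in 𝓝 p, ChartBounded j M' (f z) := by
  obtain ⟨δ, hδ, -, F, hF, hd, he⟩ := hf.exists_lift hS hp
  have hpδ := mem_ball_self (x := p) hδ
  have hc : ContinuousAt F p := hd.continuousOn.continuousAt (ball_mem_nhds p hδ)
  have hj : F p j ≠ 0 := by
    intro h0
    rw [he p hpδ, chartBounded_mk] at hM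
    exact hF p hpδ (funext fun l => by simpa [h0] using hM l)
  rw [he p hpδ, chartBounded_mk] at hM
  have hall : ∀ᶠ z in 𝓝 p, ∀ l, ‖F z l‖ < M' * ‖F z j‖ := by
    refine eventually_all.2 fun l => ?_
    have h1 : ContinuousAt (fun z => ‖F z l‖) p := ((continuousAt_pi.1 hc) l).norm
    have h2 : ContinuousAt (fun z => M' * ‖F z j‖) p :=
      ((continuousAt_pi.1 hc) j).norm.const_mul M'
    exact h1.eventually_lt h2
      ((hM l).trans_lt (mul_lt_mul_of_pos_right hMM' (norm_pos_iff.2 hj)))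
  filter_upwards [hall, ball_mem_nhds p hδ] with z hz hzδ
  rw [he z hzδ, chartBounded_mk]
  exact fun l => (hz l).le

theorem IsHolomorphicOnP.chartBounded_of_frequently (hf : IsHolomorphicOnP S f) (hS : IsOpen S)
    {p : E} (hp : p ∈ S) {j : Fin (m + 1)} {M : ℝ}
    (hM : ∃ᶠ z in 𝓝 p, ChartBounded j M (f z)) : ChartBounded j M (f p) := by
  obtain ⟨δ, hδ, -, F, hF, hd, he⟩ := hf.exists_lift hS hp
  have hc : ContinuousAt F p := hd.continuousOn.continuousAt (ball_mem_nhds p hδ)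
  rw [he p (mem_ball_self hδ), chartBounded_mk]
  by_contra! hcon
  obtain ⟨l, hl⟩ := hcon
  have h1 : ContinuousAt (fun z => ‖F z l‖) p := ((continuousAt_pi.1 hc) l).norm
  have h2 : ContinuousAt (fun z => M * ‖F z j‖) p :=
    ((continuousAt_pi.1 hc) j).norm.const_mul M
  obtain ⟨z, hz, hz1, hz2⟩ :=
    (hM.and_eventually ((h2.eventually_lt h1 hl).and (ball_mem_nhds p hδ))).exists
  rw [he z hz2, chartBounded_mk] at hz
  exact absurd (hz l) (not_le.2 hz1)

theorem IsHolomorphicOnP.differentiableAt_projRatio (hf : IsHolomorphicOnP S f) (hS : IsOpen S)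
    {p : E} (hp : p ∈ S) {j : Fin (m + 1)} (hj : (f p).rep j ≠ 0) :
    DifferentiableAt ℂ (fun z => projRatio j (f z)) p := by
  obtain ⟨δ, hδ, -, F, hF, hd, he⟩ := hf.exists_lift hS hp
  have hpδ := mem_ball_self (x := p) hδ
  have hj' : F p j ≠ 0 := by
    obtain ⟨a, ha⟩ := Projectivization.exists_smul_eq_mk_rep ℂ (F p) (hF p hpδ)
    rw [he p hpδ, ← ha] at hj
    intro h0
    simp [h0] at hj
  have hFd := differentiableAt_pi.1 (hd.differentiableAt (ball_mem_nhds p hδ))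
  have h1 : DifferentiableAt ℂ (fun z l => F z l / F z j) p :=
    differentiableAt_pi.2 fun l => by
      simpa only [div_eq_mul_inv] using! (hFd l).mul ((hFd j).inv hj')
  refine h1.congr_of_eventuallyEq ?_
  filter_upwards [ball_mem_nhds p hδ] with z hz
  rw [he z hz, projRatio_mk]

theorem isHolomorphicOnP_of_projRatio {U : Set E} (hU : IsOpen U) {j : Fin (m + 1)}
    (hj : ∀ z ∈ U, (f z).rep j ≠ 0)
    (hd : DifferentiableOn ℂ (fun z => projRatio j (f z)) U) : IsHolomorphicOnP U f :=
  fun _ hz => ⟨U, hU, hz, _, fun w hw => projRatio_ne_zero (hj w hw), hd,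
    fun w hw _ => (mk_projRatio (hj w hw)).symm⟩

/-- Identity theorem: a relation `f_l = g f_j` between homogeneous coordinates of a
projective-space-valued holomorphic map propagates. -/
theorem IsHolomorphicOnP.rep_eq_mul {h : ℂ → Projectivization ℂ (Fin (m + 1) → ℂ)} {S : Set ℂ}
    (hh : IsHolomorphicOnP S h) (hS : IsOpen S) (hSc : IsPreconnected S) {g : ℂ → ℂ}
    (hg : DifferentiableOn ℂ g S) {j l : Fin (m + 1)} {c : ℂ} (hc : c ∈ S)
    (heq : ∀ᶠ x in 𝓝 c, (h x).rep l = g x * (h x).rep j) :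
    ∀ x ∈ S, (h x).rep l = g x * (h x).rep j := by
  have key : S ⊆ {x | ∀ᶠ z in 𝓝 x, (h z).rep l = g z * (h z).rep j} := by
    refine hSc.subset_of_closure_inter_subset isOpen_setOfPred_eventually_nhds ⟨c, hc, heq⟩ ?_
    rintro x ⟨hx, hxS⟩
    obtain ⟨δ, hδ, hsub, F, hF, hd, he⟩ := hh.exists_lift hS hxS
    have hiff : ∀ z ∈ ball x δ,
        ((h z).rep l = g z * (h z).rep j ↔ F z l - g z * F z j = 0) := by
      intro z hz
      obtain ⟨a, ha⟩ := Projectivization.exists_smul_eq_mk_rep ℂ (F z) (hF z hz)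
      rw [he z hz, ← ha]
      simp only [Pi.smul_apply, Units.smul_def, smul_eq_mul]
      rw [mul_left_comm, mul_right_inj' a.ne_zero, sub_eq_zero]
    have hFd := differentiableOn_pi.1 hd
    have han : AnalyticOnNhd ℂ (fun z => F z l - g z * F z j) (ball x δ) :=
      ((hFd l).sub ((hg.mono hsub).mul (hFd j))).analyticOnNhd isOpen_ball
    obtain ⟨y, hyb, hy⟩ := mem_closure_iff_nhds.1 hx _ (ball_mem_nhds x hδ)
    have hz := han.eqOn_zero_of_preconnected_of_eventuallyEq_zero
      (convex_ball x δ).isPreconnected hyb (by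
        filter_upwards [hy, isOpen_ball.mem_nhds hyb] with z hz hzb
        exact (hiff z hzb).1 hz)
    filter_upwards [ball_mem_nhds x hδ] with z hzb
    exact (hiff z hzb).2 (hz hzb)
  exact fun x hx => (key hx).self_of_nhds

end Holomorphic

section Osgood

variable {T F : Type*} [NormedAddCommGroup T] [NormedSpace ℂ T]
  [NormedAddCommGroup F] [NormedSpace ℂ F]

/-- **Osgood's lemma**: a bounded separately holomorphic function is holomorphic. -/
theorem differentiableAt_of_separately_of_bounded {u : ℂ × T → F} {x₀ : ℂ} {t₀ : T} {ρ M : ℝ}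
    (hρ : 0 < ρ)
    (hx : ∀ t ∈ ball t₀ ρ, DifferentiableOn ℂ (fun x => u (x, t)) (ball x₀ ρ))
    (ht : ∀ x ∈ ball x₀ ρ, DifferentiableOn ℂ (fun t => u (x, t)) (ball t₀ ρ))
    (hM : ∀ x ∈ ball x₀ ρ, ∀ t ∈ ball t₀ ρ, ‖u (x, t)‖ ≤ M) :
    DifferentiableAt ℂ u (x₀, t₀) := by
  have hx₀ := mem_ball_self (x := x₀) hρ
  have ht₀ := mem_ball_self (x := t₀) hρ
  have h1 : ∀ x ∈ ball x₀ ρ, ∀ t ∈ ball t₀ ρ,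
      ‖u (x, t) - u (x, t₀)‖ ≤ (M + M) / ρ * ‖t - t₀‖ := by
    intro x hxb t htb
    have := Complex.dist_le_div_mul_dist_of_mapsTo_ball (R₂ := M + M) (ht x hxb)
      (fun s hs => by
        rw [mem_closedBall, dist_eq_norm]
        exact (norm_sub_le _ _).trans (add_le_add (hM x hxb s hs) (hM x hxb t₀ ht₀))) htb
    simpa [dist_eq_norm] using this
  have h2 : ∀ x ∈ ball x₀ ρ, ∀ t ∈ ball t₀ ρ,
      ‖u (x, t) - u (x, t₀) - (u (x₀, t) - u (x₀, t₀))‖ ≤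
        ((M + M) / ρ * ‖t - t₀‖ + (M + M) / ρ * ‖t - t₀‖) / ρ * ‖x - x₀‖ := by
    intro x hxb t htb
    have := Complex.dist_le_div_mul_dist_of_mapsTo_ball
      (f := fun x => u (x, t) - u (x, t₀))
      (R₂ := (M + M) / ρ * ‖t - t₀‖ + (M + M) / ρ * ‖t - t₀‖)
      ((hx t htb).sub (hx t₀ ht₀))
      (fun s hs => by
        rw [mem_closedBall, dist_eq_norm]
        exact (norm_sub_le _ _).trans (add_le_add (h1 s hs t htb) (h1 x₀ hx₀ t htb))) hxb
    simpa [dist_eq_norm] using this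
  have hM0 : 0 ≤ M := (norm_nonneg _).trans (hM x₀ hx₀ t₀ ht₀)
  have h3 : HasFDerivAt
      (fun z : ℂ × T => u z - u (z.1, t₀) - (u (x₀, z.2) - u (x₀, t₀)))
      (0 : ℂ × T →L[ℂ] F) (x₀, t₀) := by
    refine Asymptotics.IsBigO.hasFDerivAt (n := 2) ?_ one_lt_two
    refine Asymptotics.IsBigO.of_bound (4 * M / ρ / ρ) ?_
    filter_upwards [ball_mem_nhds (x₀, t₀) hρ] with z hz
    rw [← ball_prod_same] at hz
    refine (h2 z.1 hz.1 z.2 hz.2).trans ?_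
    have ha : ‖z.1 - x₀‖ ≤ ‖z - (x₀, t₀)‖ := norm_fst_le (z - (x₀, t₀))
    have hb : ‖z.2 - t₀‖ ≤ ‖z - (x₀, t₀)‖ := norm_snd_le (z - (x₀, t₀))
    rw [Real.norm_of_nonneg (by positivity)]
    calc _ = 4 * M / ρ / ρ * (‖z.2 - t₀‖ * ‖z.1 - x₀‖) := by ring
      _ ≤ 4 * M / ρ / ρ * (‖z - (x₀, t₀)‖ * ‖z - (x₀, t₀)‖) := by gcongr
      _ = _ := by ring
  have h4 : DifferentiableAt ℂ (fun z : ℂ × T => u (z.1, t₀)) (x₀, t₀) :=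
    DifferentiableAt.comp (x₀, t₀) (g := fun x => u (x, t₀)) (f := Prod.fst)
      ((hx t₀ ht₀).differentiableAt (ball_mem_nhds x₀ hρ)) differentiableAt_fst
  have h5 : DifferentiableAt ℂ (fun z : ℂ × T => u (x₀, z.2)) (x₀, t₀) :=
    DifferentiableAt.comp (x₀, t₀) (g := fun t => u (x₀, t)) (f := Prod.snd)
      ((ht x₀ hx₀).differentiableAt (ball_mem_nhds t₀ hρ)) differentiableAt_snd
  have h6 := (h3.differentiableAt.add (h5.sub_const (u (x₀, t₀)))).add h4
  refine h6.congr_of_eventuallyEq (Eventually.of_forall fun z => ?_)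
  simp

end Osgood

section TaylorCoefficients

variable {T : Type*} [NormedAddCommGroup T] [NormedSpace ℂ T]

theorem iteratedDeriv_div_factorial_eq_iterate_dslope {g : ℂ → ℂ} {c : ℂ} {R : ℝ} (hR : 0 < R)
    (hg : DifferentiableOn ℂ g (ball c R)) (i : ℕ) :
    iteratedDeriv i g c / i.factorial = (Function.swap dslope c)^[i] g c := by
  have hp := (hg.analyticAt (ball_mem_nhds c hR)).hasFPowerSeriesAt
  have h1 := (hp.has_fpower_series_iterate_dslope_fslope i).coeff_zero 1
  rw [← h1]
  have h2 := FormalMultilinearSeries.coeff_iterate_fslope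
    (p := FormalMultilinearSeries.ofScalars ℂ (fun n ↦ iteratedDeriv n g c / n.factorial)) i 0
  rw [FormalMultilinearSeries.coeff_ofScalars, zero_add] at h2
  exact h2.symm

theorem norm_iteratedDeriv_div_factorial_le {g : ℂ → ℂ} {c : ℂ} {R M : ℝ} (hR : 0 < R)
    (hg : DifferentiableOn ℂ g (closedBall c R)) (hM : ∀ x ∈ closedBall c R, ‖g x‖ ≤ M)
    (i : ℕ) : ‖iteratedDeriv i g c / i.factorial‖ ≤ M / R ^ i := by
  have h := Complex.norm_iteratedDeriv_le_of_forall_mem_sphere_norm_le i hR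
    (hg.mono closure_ball_subset_closedBall).diffContOnCl
    fun z hz => hM z (sphere_subset_closedBall hz)
  have hpos : (0 : ℝ) < i.factorial := by positivity
  rw [norm_div, Complex.norm_natCast, div_le_iff₀ hpos]
  exact h.trans_eq (by ring)

/-- A continuous function on `K` that is holomorphic along complex lines. -/
def LineHolomorphicOn (K : Set T) (g : T → ℂ) : Prop :=
  ContinuousOn g K ∧ ∀ t s : T, DifferentiableOn ℂ (fun ζ : ℂ => g (t + ζ • s)) {ζ | t + ζ • s ∈ K}

theorem DifferentiableOn.lineHolomorphicOn {K : Set T} {g : T → ℂ}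
    (hg : DifferentiableOn ℂ g K) : LineHolomorphicOn K g :=
  ⟨hg.continuousOn, fun t s => DifferentiableOn.comp (g := g) (f := fun ζ : ℂ => t + ζ • s)
    (t := K) hg (by fun_prop) fun _ h => h⟩

theorem LineHolomorphicOn.const_mul_sub {K : Set T} {g h : T → ℂ} (hg : LineHolomorphicOn K g)
    (hh : LineHolomorphicOn K h) (a : ℂ) : LineHolomorphicOn K fun t => a * (g t - h t) :=
  ⟨continuousOn_const.mul (hg.1.sub hh.1), fun t s => ((hg.2 t s).sub (hh.2 t s)).const_mul a⟩

theorem TendstoUniformlyOn.lineHolomorphicOn {K : Set T} (hK : IsOpen K) {G : ℕ → T → ℂ}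
    {g : T → ℂ} (h : TendstoUniformlyOn G g atTop K) (hG : ∀ n, LineHolomorphicOn K (G n)) :
    LineHolomorphicOn K g := by
  refine ⟨h.continuousOn (Frequently.of_forall fun n => (hG n).1), fun t s => ?_⟩
  have hopen : IsOpen {ζ : ℂ | t + ζ • s ∈ K} :=
    hK.preimage (f := fun ζ : ℂ => t + ζ • s) (by fun_prop)
  exact (h.comp fun ζ : ℂ => t + ζ • s).tendstoLocallyUniformlyOn.differentiableOn
    (Eventually.of_forall fun n => (hG n).2 t s) hopen

theorem lineHolomorphicOn_iterate_dslope {K : Set T} (hK : IsOpen K) {c : ℂ} {ε : ℝ}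
    (hε : 0 < ε) (i : ℕ) : ∀ {U : ℂ → T → ℂ} {M : ℝ},
    (∀ t ∈ K, DifferentiableOn ℂ (fun x => U x t) (ball c ε)) →
    (∀ x ∈ ball c ε, LineHolomorphicOn K (U x)) →
    (∀ x ∈ ball c ε, ∀ t ∈ K, ‖U x t‖ ≤ M) →
    LineHolomorphicOn K fun t => (Function.swap dslope c)^[i] (fun x => U x t) c := by
  have hc : c ∈ ball c ε := mem_ball_self hε
  have hmaps : ∀ {g : ℂ → ℂ} {M : ℝ}, (∀ x ∈ ball c ε, ‖g x‖ ≤ M) →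
      MapsTo g (ball c ε) (closedBall (g c) (M + M)) := by
    intro g M hM x hx
    rw [mem_closedBall, dist_eq_norm]
    exact (norm_sub_le _ _).trans (add_le_add (hM x hx) (hM c hc))
  induction i with
  | zero => exact fun _ hl _ => hl c hc
  | succ i ih =>
    intro U M hx hl hM
    have hx' : ∀ t ∈ K, DifferentiableOn ℂ (fun x => dslope (fun x => U x t) c x) (ball c ε) :=
      fun t ht => (Complex.differentiableOn_dslope (ball_mem_nhds c hε)).2 (hx t ht)
    have hM' : ∀ x ∈ ball c ε, ∀ t ∈ K, ‖dslope (fun x => U x t) c x‖ ≤ (M + M) / ε :=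
      fun x hxb t ht => Complex.norm_dslope_le_div_of_mapsTo_ball (hx t ht)
        (hmaps fun x hx => hM x hx t ht) hxb
    have hne : ∀ x ∈ ball c ε, x ≠ c →
        LineHolomorphicOn K fun t => dslope (fun x => U x t) c x := by
      intro x hxb hxc
      have : (fun t => dslope (fun x => U x t) c x) = fun t => (x - c)⁻¹ * (U x t - U c t) := by
        funext t
        rw [dslope_of_ne _ hxc, slope_def_field, div_eq_inv_mul]
      rw [this]
      exact (hl x hxb).const_mul_sub (hl c hc) _
    refine ih (U := fun x t => dslope (fun x => U x t) c x) (M := (M + M) / ε) hx' ?_ hM'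
    intro x hxb
    by_cases hxc : x = c
    swap
    · exact hne x hxb hxc
    subst hxc
    let xs : ℕ → ℂ := fun n => x + ((ε / (n + 2) : ℝ) : ℂ)
    have hdist : ∀ n, dist (xs n) x = ε / (n + 2) := by
      intro n
      have : (0 : ℝ) ≤ ε / (n + 2) := by positivity
      simp only [xs, dist_eq_norm, add_sub_cancel_left, Complex.norm_real]
      exact Real.norm_of_nonneg this
    have hxs : ∀ n, xs n ∈ ball x ε := by
      intro n
      rw [mem_ball, hdist]
      exact div_lt_self hε (by have : (0 : ℝ) ≤ n := n.cast_nonneg; linarith)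
    have hxs' : ∀ n, xs n ≠ x := by
      intro n hn
      have := hdist n
      rw [hn, dist_self] at this
      have h2 : (0 : ℝ) < ε / (n + 2) := by positivity
      linarith
    refine TendstoUniformlyOn.lineHolomorphicOn hK
      (G := fun n t => dslope (fun x => U x t) x (xs n)) ?_ fun n => hne _ (hxs n) (hxs' n)
    rw [Metric.tendstoUniformlyOn_iff]
    intro η hη
    set B := (M + M) / ε with hB
    have hlim : Tendsto (fun n : ℕ => (B + B) / ε * (ε / (n + 2))) atTop (𝓝 0) := by
      have h1 : Tendsto (fun n : ℕ => (n : ℝ) + 2) atTop atTop :=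
        tendsto_atTop_add_const_right _ _ tendsto_natCast_atTop_atTop
      simpa using (h1.const_div_atTop ε).const_mul ((B + B) / ε)
    filter_upwards [hlim.eventually (gt_mem_nhds hη)] with n hn t ht
    rw [dist_comm]
    refine (Complex.dist_le_div_mul_dist_of_mapsTo_ball (hx' t ht)
      (hmaps fun x hx => hM' x hx t ht) (hxs n)).trans_lt ?_
    rw [hdist]
    exact hn

theorem lineHolomorphicOn_iteratedDeriv {K : Set T} (hK : IsOpen K) {c : ℂ} {ε : ℝ}
    (hε : 0 < ε) {U : ℂ → T → ℂ} {M : ℝ}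
    (hx : ∀ t ∈ K, DifferentiableOn ℂ (fun x => U x t) (ball c ε))
    (ht : ∀ x ∈ ball c ε, DifferentiableOn ℂ (U x) K)
    (hM : ∀ x ∈ ball c ε, ∀ t ∈ K, ‖U x t‖ ≤ M) (i : ℕ) :
    LineHolomorphicOn K fun t => iteratedDeriv i (fun x => U x t) c / i.factorial := by
  have h := lineHolomorphicOn_iterate_dslope hK hε i hx (fun x hx => (ht x hx).lineHolomorphicOn) hM
  have heq : ∀ t ∈ K, iteratedDeriv i (fun x => U x t) c / i.factorial =
      (Function.swap dslope c)^[i] (fun x => U x t) c :=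
    fun t htK => iteratedDeriv_div_factorial_eq_iterate_dslope hε (hx t htK) i
  exact ⟨h.1.congr heq, fun t s => (h.2 t s).congr fun ζ hζ => heq _ hζ⟩

end TaylorCoefficients

section Submean

theorem posLog_norm_le_circleAverage {g : ℂ → ℂ} {D : Set ℂ} (hD : IsOpen D)
    (hsub : closedBall 0 1 ⊆ D) (hg : DifferentiableOn ℂ g D) :
    log⁺ ‖g 0‖ ≤ circleAverage (fun z => log⁺ ‖g z‖) 0 1 := by
  have hnn : 0 ≤ circleAverage (fun z => log⁺ ‖g z‖) 0 1 :=
    circleAverage_nonneg_of_nonneg fun _ _ => posLog_nonneg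
  by_cases h0 : g 0 = 0
  · simpa [h0] using hnn
  have han : AnalyticOnNhd ℂ g (closedBall 0 |1|) := by
    rw [abs_one]
    exact (hg.analyticOnNhd hD).mono hsub
  have hJ := han.circleAverage_log_norm one_ne_zero h0
  have hsum : 0 ≤ ∑ᶠ u, MeromorphicOn.divisor g (closedBall 0 |1|) u *
      Real.log (1 * ‖0 - u‖⁻¹) := by
    refine finsum_nonneg fun u => ?_
    by_cases hu : u ∈ closedBall (0 : ℂ) |1|
    · refine mul_nonneg ?_ ?_
      · exact_mod_cast (MeromorphicOn.AnalyticOnNhd.divisor_nonneg han) u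
      · rw [zero_sub, norm_neg, one_mul, Real.log_inv, neg_nonneg]
        refine Real.log_nonpos (norm_nonneg u) ?_
        simpa using hu
    · rw [Function.locallyFinsuppWithin.apply_eq_zero_of_notMem _ hu]
      simp
  have hcont : ContinuousOn g (sphere 0 |1|) := by
    rw [abs_one]
    exact hg.continuousOn.mono (sphere_subset_closedBall.trans hsub)
  have hmono : circleAverage (Real.log ‖g ·‖) 0 1 ≤ circleAverage (fun z => log⁺ ‖g z‖) 0 1 := by
    refine circleAverage_mono ?_ ?_ fun z _ => le_max_right _ _
    · exact MeromorphicOn.circleIntegrable_log_norm fun z hz =>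
        (han z (sphere_subset_closedBall hz)).meromorphicAt
    · exact ContinuousOn.circleIntegrable' (continuous_posLog.comp_continuousOn hcont.norm)
  exact max_le hnn (by linarith)

theorem ofReal_posLog_norm_le_lintegral {g : ℂ → ℂ} {D : Set ℂ} (hD : IsOpen D)
    (hsub : closedBall 0 1 ⊆ D) (hg : DifferentiableOn ℂ g D) :
    ENNReal.ofReal (2 * π) * ENNReal.ofReal (log⁺ ‖g 0‖) ≤
      ∫⁻ θ in Ioc 0 (2 * π), ENNReal.ofReal (log⁺ ‖g (circleMap 0 1 θ)‖) := by
  have h := posLog_norm_le_circleAverage hD hsub hg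
  have hpi : 0 < 2 * π := by positivity
  have hcont : Continuous fun θ => log⁺ ‖g (circleMap 0 1 θ)‖ := by
    refine continuous_posLog.comp (Continuous.norm ?_)
    refine hg.continuousOn.comp_continuous (continuous_circleMap 0 1) fun θ => hsub ?_
    exact sphere_subset_closedBall (circleMap_mem_sphere 0 zero_le_one θ)
  rw [circleAverage_def, smul_eq_mul, ← div_eq_inv_mul, le_div_iff₀ hpi, mul_comm,
    intervalIntegral.integral_of_le hpi.le] at h
  rw [← ENNReal.ofReal_mul hpi.le, ← ofReal_integral_eq_lintegral_ofReal]
  · exact ENNReal.ofReal_le_ofReal h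
  · exact (intervalIntegrable_iff_integrableOn_Ioc_of_le hpi.le).1 (hcont.intervalIntegrable _ _)
  · exact Eventually.of_forall fun _ => posLog_nonneg

theorem measurePreserving_smul_of_norm_eq_one (d : ℕ) {a : ℂ} (ha : ‖a‖ = 1) :
    MeasurePreserving (fun t : ℂ × (Fin d → ℂ) => a • t) := by
  have h1 : MeasurePreserving (fun z : ℂ => a * z) :=
    (rotation ⟨a, by simp [Submonoid.unitSphere, ha]⟩).measurePreserving
  exact h1.prod (volume_preserving_pi fun _ => h1)

theorem volume_mul_ofReal_posLog_le {d : ℕ} {O K : Set (ℂ × (Fin d → ℂ))} (hK : IsOpen K)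
    (hbal : ∀ k ∈ K, ∀ a : ℂ, ‖a‖ ≤ 1 → a • k ∈ K) (hO : IsOpen O)
    {g : ℂ × (Fin d → ℂ) → ℂ} (hg : LineHolomorphicOn O g) {t : ℂ × (Fin d → ℂ)}
    (ht : ∀ k ∈ K, t + k ∈ O) :
    volume K * ENNReal.ofReal (log⁺ ‖g t‖) ≤ ∫⁻ k in K, ENNReal.ofReal (log⁺ ‖g (t + k)‖) := by
  classical
  set V : ℂ × (Fin d → ℂ) → ENNReal :=
    K.piecewise (fun k => ENNReal.ofReal (log⁺ ‖g (t + k)‖)) (fun _ => 0) with hV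
  have hVm : Measurable V := by
    refine ContinuousOn.measurable_piecewise ?_ continuousOn_const hK.measurableSet
    refine ENNReal.continuous_ofReal.comp_continuousOn
      (continuous_posLog.comp_continuousOn (ContinuousOn.norm ?_))
    exact hg.1.comp (by fun_prop) ht
  have hVK : ∀ k ∈ K, V k = ENNReal.ofReal (log⁺ ‖g (t + k)‖) := fun k hk => by
    rw [hV, piecewise_eq_of_mem _ _ _ hk]
  have hline : ∀ k ∈ K, ENNReal.ofReal (2 * π) * ENNReal.ofReal (log⁺ ‖g t‖) ≤
      ∫⁻ θ in Ioc 0 (2 * π), V (circleMap 0 1 θ • k) := by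
    intro k hk
    have h := ofReal_posLog_norm_le_lintegral (g := fun ζ : ℂ => g (t + ζ • k))
      (D := {ζ | t + ζ • k ∈ O}) (hO.preimage (f := fun ζ : ℂ => t + ζ • k) (by fun_prop))
      (fun ζ hζ => ht _ (hbal k hk ζ (by simpa using hζ))) (hg.2 t k)
    simp only [zero_smul, add_zero] at h
    refine h.trans_eq (lintegral_congr fun θ => ?_)
    rw [hVK _ (hbal k hk _ (by simp))]
  have hmeas : Measurable (fun p : (ℂ × (Fin d → ℂ)) × ℝ => V (circleMap 0 1 p.2 • p.1)) := by
    refine hVm.comp ?_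
    have : Continuous (fun p : (ℂ × (Fin d → ℂ)) × ℝ => circleMap 0 1 p.2 • p.1) :=
      ((continuous_circleMap 0 1).comp continuous_snd).smul continuous_fst
    exact this.measurable
  have hpi : ENNReal.ofReal (2 * π) ≠ 0 := by
    simp [ENNReal.ofReal_eq_zero, not_le, Real.pi_pos]
  have hVint : ∫⁻ k, V k = ∫⁻ k in K, ENNReal.ofReal (log⁺ ‖g (t + k)‖) := by
    have : V = K.indicator fun k => ENNReal.ofReal (log⁺ ‖g (t + k)‖) := piecewise_eq_indicator
    rw [this, lintegral_indicator hK.measurableSet]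
  rw [← hVint, ← ENNReal.mul_le_mul_iff_right hpi ENNReal.ofReal_ne_top]
  calc ENNReal.ofReal (2 * π) * (volume K * ENNReal.ofReal (log⁺ ‖g t‖))
      = ∫⁻ _k in K, ENNReal.ofReal (2 * π) * ENNReal.ofReal (log⁺ ‖g t‖) := by
        rw [setLIntegral_const]; ring
    _ ≤ ∫⁻ k in K, ∫⁻ θ in Ioc 0 (2 * π), V (circleMap 0 1 θ • k) :=
        setLIntegral_mono' hK.measurableSet hline
    _ ≤ ∫⁻ k, ∫⁻ θ in Ioc 0 (2 * π), V (circleMap 0 1 θ • k) := setLIntegral_le_lintegral _ _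
    _ = ∫⁻ θ in Ioc 0 (2 * π), ∫⁻ k, V (circleMap 0 1 θ • k) :=
        lintegral_lintegral_swap hmeas.aemeasurable
    _ = ∫⁻ _θ in Ioc 0 (2 * π), ∫⁻ k, V k := by
        refine lintegral_congr fun θ => ?_
        exact (measurePreserving_smul_of_norm_eq_one d (by simp)).lintegral_comp hVm
    _ = ENNReal.ofReal (2 * π) * ∫⁻ k, V k := by
        rw [setLIntegral_const, Real.volume_Ioc, sub_zero, mul_comm]

end Submean

section Extension

variable {m : ℕ}

theorem norm_le_div_pow_of_volume_diff_le {d : ℕ} {ε τ ρ R R' M : ℝ} (hτε : τ ≤ ε)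
    (hτ : 0 < τ) (hρ : 0 < ρ) (hρR : ρ ≤ R) (hR' : 0 < R') (hR'R : R' ≤ R) (hM : 0 < M)
    {Z : Set (Fin d → ℂ)} (hZ : MeasurableSet Z)
    (hsmall : ENNReal.ofReal (Real.log (R / ρ)) * volume (ball 0 ε \ Z) ≤
      volume (ball (0 : Fin d → ℂ) (ε / 2)) * ENNReal.ofReal (Real.log (R / R')))
    {b : ℂ × (Fin d → ℂ) → ℂ} (hb : LineHolomorphicOn (ball 0 ε) b) (i : ℕ)
    (h1 : ∀ t ∈ ball (0 : ℂ × (Fin d → ℂ)) ε, ‖b t‖ ≤ M / ρ ^ i)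
    (h2 : ∀ w ∈ ball (0 : ℂ) τ, ∀ y ∈ Z, ‖b (w, y)‖ ≤ M / R ^ i) :
    ∀ w ∈ ball (0 : ℂ) (τ / 2), ∀ y ∈ ball (0 : Fin d → ℂ) (ε / 2), ‖b (w, y)‖ ≤ M / R' ^ i := by
  intro w hw y hy
  have hR : 0 < R := hR'.trans_le hR'R
  have hε : 0 < ε := hτ.trans_le hτε
  set g : ℂ × (Fin d → ℂ) → ℂ := fun t => ((R ^ i / M : ℝ) : ℂ) * (b t - 0) with hg
  have hgl : LineHolomorphicOn (ball 0 ε) g :=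
    hb.const_mul_sub (differentiableOn_const (0 : ℂ)).lineHolomorphicOn _
  have hgn : ∀ t, ‖g t‖ = R ^ i / M * ‖b t‖ := fun t => by
    rw [hg]
    simp only [sub_zero, norm_mul, Complex.norm_real]
    rw [Real.norm_of_nonneg (by positivity)]
  have hadd : ∀ k ∈ ball (0 : ℂ) (τ / 2) ×ˢ ball (0 : Fin d → ℂ) (ε / 2),
      w + k.1 ∈ ball (0 : ℂ) τ ∧ y + k.2 ∈ ball (0 : Fin d → ℂ) ε := by
    rintro ⟨k1, k2⟩ ⟨hk1, hk2⟩
    simp only [mem_ball_zero_iff] at *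
    exact ⟨(norm_add_le _ _).trans_lt (by linarith), (norm_add_le _ _).trans_lt (by linarith)⟩
  have hmem : ∀ k ∈ ball (0 : ℂ) (τ / 2) ×ˢ ball (0 : Fin d → ℂ) (ε / 2),
      (w, y) + k ∈ ball (0 : ℂ × (Fin d → ℂ)) ε := by
    intro k hk
    obtain ⟨ha, hb⟩ := hadd k hk
    simp only [mem_ball_zero_iff] at ha hb ⊢
    exact max_lt (ha.trans_le hτε) hb
  have hlog : 0 ≤ Real.log (R / ρ) := Real.log_nonneg ((one_le_div hρ).2 hρR)
  have hlog' : 0 ≤ Real.log (R / R') := Real.log_nonneg ((one_le_div hR').2 hR'R)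
  have hsub := volume_mul_ofReal_posLog_le (isOpen_ball.prod isOpen_ball) (K :=
    ball (0 : ℂ) (τ / 2) ×ˢ ball (0 : Fin d → ℂ) (ε / 2)) (fun k hk a ha => by
      simp only [mem_prod, mem_ball_zero_iff, Prod.smul_fst, Prod.smul_snd] at hk ⊢
      exact ⟨(norm_smul_le _ _).trans_lt
        ((mul_le_of_le_one_left (norm_nonneg _) ha).trans_lt hk.1),
        (norm_smul_le _ _).trans_lt
        ((mul_le_of_le_one_left (norm_nonneg _) ha).trans_lt hk.2)⟩)
    isOpen_ball hgl hmem
  set W : Set (Fin d → ℂ) := (fun k => y + k) ⁻¹' (ball 0 ε \ Z) with hW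
  have hWm : MeasurableSet W := (measurableSet_ball.diff hZ).preimage (measurable_const_add y)
  have hpt : ∀ k ∈ ball (0 : ℂ) (τ / 2) ×ˢ ball (0 : Fin d → ℂ) (ε / 2),
      ENNReal.ofReal (log⁺ ‖g ((w, y) + k)‖) ≤
        (ball (0 : ℂ) (τ / 2) ×ˢ W).indicator
          (fun _ => ENNReal.ofReal (i * Real.log (R / ρ))) k := by
    intro k hk
    by_cases hkZ : y + k.2 ∈ Z
    · have : ‖g ((w, y) + k)‖ ≤ 1 := by
        rw [hgn]
        have := h2 _ (hadd k hk).1 _ hkZ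
        calc R ^ i / M * ‖b ((w, y) + k)‖ ≤ R ^ i / M * (M / R ^ i) := by gcongr; exact this
          _ = 1 := by field_simp
      rw [(posLog_eq_zero_iff _).2 (by rwa [abs_norm])]
      simp
    · have hkW : k ∈ ball (0 : ℂ) (τ / 2) ×ˢ W := ⟨hk.1, (hadd k hk).2, hkZ⟩
      rw [indicator_of_mem hkW]
      refine ENNReal.ofReal_le_ofReal ?_
      have h3 : ‖g ((w, y) + k)‖ ≤ (R / ρ) ^ i := by
        rw [hgn]
        calc R ^ i / M * ‖b ((w, y) + k)‖ ≤ R ^ i / M * (M / ρ ^ i) := by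
              gcongr; exact h1 _ (hmem k hk)
          _ = _ := by rw [div_pow]; field_simp
      refine (posLog_le_posLog (norm_nonneg _) h3).trans_eq ?_
      rw [posLog_eq_log (by
        rw [abs_of_nonneg (by positivity)]
        exact one_le_pow₀ ((one_le_div hρ).2 hρR)), Real.log_pow]
  have hfin : volume (ball (0 : ℂ) (τ / 2)) ≠ ⊤ := measure_ball_lt_top.ne
  have hpos : volume (ball (0 : ℂ) (τ / 2)) ≠ 0 := (measure_ball_pos _ _ (by positivity)).ne'
  have hfin' : volume (ball (0 : Fin d → ℂ) (ε / 2)) ≠ ⊤ := measure_ball_lt_top.ne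
  have hpos' : volume (ball (0 : Fin d → ℂ) (ε / 2)) ≠ 0 :=
    (measure_ball_pos _ _ (by positivity)).ne'
  have hbound : volume (ball (0 : ℂ) (τ / 2)) * (volume (ball (0 : Fin d → ℂ) (ε / 2)) *
      ENNReal.ofReal (log⁺ ‖g (w, y)‖)) ≤ volume (ball (0 : ℂ) (τ / 2)) *
        (volume (ball (0 : Fin d → ℂ) (ε / 2)) * ENNReal.ofReal (i * Real.log (R / R'))) := by
    calc _ = volume (ball (0 : ℂ) (τ / 2) ×ˢ ball (0 : Fin d → ℂ) (ε / 2)) *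
          ENNReal.ofReal (log⁺ ‖g (w, y)‖) := by
          rw [Measure.volume_eq_prod, Measure.prod_prod, mul_assoc]
      _ ≤ _ := hsub
      _ ≤ ∫⁻ k in ball (0 : ℂ) (τ / 2) ×ˢ ball (0 : Fin d → ℂ) (ε / 2),
          (ball (0 : ℂ) (τ / 2) ×ˢ W).indicator
            (fun _ => ENNReal.ofReal (i * Real.log (R / ρ))) k :=
          setLIntegral_mono' (measurableSet_ball.prod measurableSet_ball) hpt
      _ ≤ ∫⁻ k, (ball (0 : ℂ) (τ / 2) ×ˢ W).indicator
            (fun _ => ENNReal.ofReal (i * Real.log (R / ρ))) k := setLIntegral_le_lintegral _ _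
      _ = ENNReal.ofReal (i * Real.log (R / ρ)) *
          (volume (ball (0 : ℂ) (τ / 2)) * volume (ball 0 ε \ Z)) := by
          rw [lintegral_indicator_const (measurableSet_ball.prod hWm), Measure.volume_eq_prod,
            Measure.prod_prod, hW, measure_preimage_add]
      _ = volume (ball (0 : ℂ) (τ / 2)) * (ENNReal.ofReal i *
          (ENNReal.ofReal (Real.log (R / ρ)) * volume (ball 0 ε \ Z))) := by
          rw [ENNReal.ofReal_mul (by positivity)]; ring
      _ ≤ volume (ball (0 : ℂ) (τ / 2)) * (ENNReal.ofReal i *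
          (volume (ball (0 : Fin d → ℂ) (ε / 2)) * ENNReal.ofReal (Real.log (R / R')))) := by
          gcongr
      _ = _ := by rw [ENNReal.ofReal_mul (p := (i : ℝ)) (by positivity)]; ring
  rw [ENNReal.mul_le_mul_iff_right hpos hfin, ENNReal.mul_le_mul_iff_right hpos' hfin',
    ENNReal.ofReal_le_ofReal_iff (by positivity)] at hbound
  have hgle : ‖g (w, y)‖ ≤ (R / R') ^ i := by
    by_cases h0 : ‖g (w, y)‖ = 0
    · rw [h0]; positivity
    refine (Real.log_le_log_iff ((norm_nonneg _).lt_of_ne' h0) (by positivity)).1 ?_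
    rw [Real.log_pow]
    exact (le_max_right _ _).trans hbound
  rw [hgn, div_mul_eq_mul_div, div_le_iff₀ hM, div_pow, div_mul_eq_mul_div,
    le_div_iff₀ (by positivity), mul_assoc, mul_le_mul_iff_right₀ (by positivity)] at hgle
  rwa [le_div_iff₀ (by positivity)]

theorem exists_volume_diff_mul_le {d : ℕ} {B : Set (Fin d → ℂ)} (hB : MeasurableSet B)
    (hBfin : volume B ≠ ⊤) {Z : ℕ → Set (Fin d → ℂ)} (hZ : ∀ N, MeasurableSet (Z N))
    (hmono : Monotone Z) (hcover : B ⊆ ⋃ N, Z N) {A D : ENNReal} (hA : A ≠ ⊤) (hD : 0 < D) :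
    ∃ N, A * volume (B \ Z N) ≤ D := by
  have h := tendsto_measure_iInter_atTop (μ := volume) (s := fun N => B \ Z N)
    (fun N => (hB.diff (hZ N)).nullMeasurableSet)
    (fun _ _ h => sdiff_subset_sdiff_right (hmono h))
    ⟨0, measure_ne_top_of_subset sdiff_subset hBfin⟩
  have hempty : ⋂ N, B \ Z N = ∅ := by
    rw [← sdiff_iUnion, sdiff_eq_empty.2 hcover]
  rw [hempty, measure_empty] at h
  have h' := ENNReal.Tendsto.const_mul h (Or.inr hA)
  rw [mul_zero] at h'
  obtain ⟨N, hN⟩ := (h'.eventually (gt_mem_nhds hD)).exists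
  exact ⟨N, hN.le⟩

theorem IsHolomorphicOnP.chartBounded_of_taylor {h : ℂ → Projectivization ℂ (Fin (m + 1) → ℂ)}
    {c : ℂ} {ρ R R' M M' : ℝ} (hρ : 0 < ρ) (hR' : 0 < R') (hR'R : R' < R) {j : Fin (m + 1)}
    (hh : IsHolomorphicOnP (ball c R') h)
    (hd : ∀ l, DifferentiableOn ℂ (fun x => projRatio j (h x) l) (ball c ρ))
    (hM : ∀ x ∈ ball c ρ, ChartBounded j M (h x))
    (hb : ∀ i l, ‖iteratedDeriv i (fun x => projRatio j (h x) l) c / i.factorial‖ ≤ M' / R ^ i) :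
    ∀ x ∈ ball c R', ChartBounded j (M' * (1 - R' / R)⁻¹) (h x) := by
  have hR : 0 < R := hR'.trans hR'R
  have hM' : 0 ≤ M' := by simpa using (norm_nonneg _).trans (hb 0 j)
  have hq : R' / R < 1 := (div_lt_one hR).2 hR'R
  have hgeo : HasSum (fun i : ℕ => M' * (R' / R) ^ i) (M' * (1 - R' / R)⁻¹) :=
    (hasSum_geometric_of_lt_one (by positivity) hq).mul_left M'
  intro x hx l
  set a : ℕ → ℂ := fun i => iteratedDeriv i (fun x => projRatio j (h x) l) c / i.factorial with ha
  have hterm : ∀ i, ∀ z ∈ ball c R', ‖a i * (z - c) ^ i‖ ≤ M' * (R' / R) ^ i := by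
    intro i z hz
    rw [mem_ball, dist_eq_norm] at hz
    calc ‖a i * (z - c) ^ i‖ = ‖a i‖ * ‖z - c‖ ^ i := by rw [norm_mul, norm_pow]
      _ ≤ M' / R ^ i * R' ^ i := by
        gcongr
        exact hb i l
      _ = _ := by rw [div_pow]; ring
  have hG : DifferentiableOn ℂ (fun z => ∑' i, a i * (z - c) ^ i) (ball c R') :=
    Complex.differentiableOn_tsum_of_summable_norm hgeo.summable
      (fun i => by fun_prop) isOpen_ball hterm
  have hid := hh.rep_eq_mul isOpen_ball (convex_ball c R').isPreconnected hG
    (mem_ball_self hR') (j := j) (l := l) (by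
      filter_upwards [ball_mem_nhds c hρ] with z hz
      have hs := Complex.hasSum_taylorSeries_on_ball (hd l) hz
      have : ∑' i, a i * (z - c) ^ i = projRatio j (h z) l := by
        rw [← hs.tsum_eq]
        refine tsum_congr fun i => ?_
        rw [ha]
        simp only [smul_eq_mul]
        ring
      rw [this, projRatio, div_mul_cancel₀ _ (hM z hz).rep_ne_zero]) x hx
  rw [hid, norm_mul]
  gcongr
  exact tsum_of_norm_bounded hgeo fun i => hterm i x hx

end Extension

section Local

variable {m : ℕ}

theorem IsHolomorphicOnP.isClosed_setOf_chartBounded {E : Type} [NormedAddCommGroup E]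
    [NormedSpace ℂ E] {f : E → Projectivization ℂ (Fin (m + 1) → ℂ)} {S B : Set E}
    (hf : IsHolomorphicOnP S f) (hS : IsOpen S) (hB : IsOpen B) (hBS : B ⊆ S) (j : Fin (m + 1))
    (M : ℝ) : IsClosed {z | z ∈ B → ChartBounded j M (f z)} := by
  refine isClosed_iff_frequently.2 fun z hz hzB => ?_
  refine hf.chartBounded_of_frequently hS (hBS hzB) ?_
  exact (hz.and_eventually (hB.mem_nhds hzB)).mono fun w hw => hw.1 hw.2

theorem IsHolomorphicOnP.exists_chartBounded_tube
    {g : ℂ × ℂ → Projectivization ℂ (Fin (m + 1) → ℂ)} {S : Set (ℂ × ℂ)}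
    (hg : IsHolomorphicOnP S g) (hS : IsOpen S) {K : Set ℂ} (hK : IsCompact K)
    (hKS : ∀ x ∈ K, (x, 0) ∈ S) {j : Fin (m + 1)} {M M' : ℝ} (hMM' : M < M')
    (hM : ∀ x ∈ K, ChartBounded j M (g (x, 0))) :
    ∃ δ > 0, ∀ x ∈ K, ∀ w ∈ ball (0 : ℂ) δ, ChartBounded j M' (g (x, w)) := by
  have h := hK.eventually_forall_of_forall_eventually (x₀ := (0 : ℂ))
    (P := fun w x => ChartBounded j M' (g (x, w))) fun x hx =>
      (continuous_swap.tendsto ((0 : ℂ), x)).eventually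
        (hg.eventually_chartBounded hS (hKS x hx) (hM x hx) hMM')
  obtain ⟨δ, hδ, hsub⟩ := Metric.eventually_nhds_iff_ball.1 h
  exact ⟨δ, hδ, fun x hx w hw => hsub w hw x hx⟩

variable {T : Type} [NormedAddCommGroup T] [NormedSpace ℂ T]
  {f : ℂ × T → Projectivization ℂ (Fin (m + 1) → ℂ)} {Ω : Set (ℂ × T)}

theorem exists_ball_chartBounded (hΩ : IsOpen Ω)
    (hx : ∀ t, IsHolomorphicOnP {x | (x, t) ∈ Ω} fun x => f (x, t))
    (ht : ∀ x, IsHolomorphicOnP {t | (x, t) ∈ Ω} fun t => f (x, t)) {r : ℝ} (hr : 0 < r)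
    (hsub : ∀ x ∈ ball (0 : ℂ) r, ∀ t ∈ ball (0 : T) r, (x, t) ∈ Ω) {j : Fin (m + 1)} {M M' : ℝ}
    (hMM' : M < M') (hM : ∀ x ∈ ball (0 : ℂ) r, ChartBounded j M (f (x, 0))) :
    ∃ c ∈ ball (0 : ℂ) r, ∃ ε > 0, ε ≤ r ∧ ball c ε ⊆ ball 0 r ∧
      ∀ x ∈ ball c ε, ∀ t ∈ ball (0 : T) ε, ChartBounded j M' (f (x, t)) := by
  have hanti : ∀ N : ℕ, r / (N + 1) ≤ r := fun N =>
    div_le_self hr.le (by linarith [N.cast_nonneg (α := ℝ)])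
  let A : ℕ → Set ℂ := fun N => ⋂ t ∈ ball (0 : T) (r / (N + 1)),
    {x | x ∈ ball (0 : ℂ) r → ChartBounded j M' (f (x, t))}
  have hA : ∀ N, IsClosed (A N) := fun N => isClosed_biInter fun t htN =>
    (hx t).isClosed_setOf_chartBounded (hΩ.preimage (by fun_prop)) isOpen_ball
      (fun x hxr => hsub x hxr t (ball_subset_ball (hanti N) htN)) j M'
  have hU : ⋃ N, A N = univ := by
    refine eq_univ_of_forall fun x => ?_
    by_cases hxr : x ∈ ball (0 : ℂ) r
    · have h := (ht x).eventually_chartBounded (hΩ.preimage (by fun_prop))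
        (hsub x hxr 0 (mem_ball_self hr)) (hM x hxr) hMM'
      obtain ⟨δ, hδ, hδsub⟩ := Metric.eventually_nhds_iff_ball.1 h
      have hlim : Tendsto (fun N : ℕ => r / ((N : ℝ) + 1)) atTop (𝓝 0) :=
        (tendsto_atTop_add_const_right _ _ tendsto_natCast_atTop_atTop).const_div_atTop r
      obtain ⟨N, hN⟩ := (hlim.eventually (gt_mem_nhds hδ)).exists
      exact mem_iUnion.2 ⟨N, mem_iInter₂.2 fun t htN _ => hδsub t (ball_subset_ball hN.le htN)⟩
    · exact mem_iUnion.2 ⟨0, mem_iInter₂.2 fun t _ h => absurd h hxr⟩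
  obtain ⟨c, hcr, hc⟩ := (dense_iUnion_interior_of_closed hA hU).exists_mem_open
    (isOpen_ball (x := (0 : ℂ)) (ε := r)) ⟨0, mem_ball_self hr⟩ |>.imp fun _ h => h.symm
  obtain ⟨N, hN⟩ := mem_iUnion.1 hc
  obtain ⟨ε₁, hε₁, hsub₁⟩ := Metric.isOpen_iff.1 (isOpen_interior.inter isOpen_ball) c ⟨hN, hcr⟩
  refine ⟨c, hcr, min ε₁ (r / (N + 1)), lt_min hε₁ (by positivity),
    (min_le_right _ _).trans (hanti N),
    fun x hx => (hsub₁ (ball_subset_ball (min_le_left _ _) hx)).2, fun x hx t ht => ?_⟩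
  have h := hsub₁ (ball_subset_ball (min_le_left _ _) hx)
  exact mem_iInter₂.1 (interior_subset h.1) t (ball_subset_ball (min_le_right _ _) ht) h.2

theorem isHolomorphicOnP_of_separately (hΩ : IsOpen Ω)
    (hx : ∀ t, IsHolomorphicOnP {x | (x, t) ∈ Ω} fun x => f (x, t))
    (ht : ∀ x, IsHolomorphicOnP {t | (x, t) ∈ Ω} fun t => f (x, t)) {V : Set (ℂ × T)}
    (hV : IsOpen V) (hVΩ : V ⊆ Ω) {j : Fin (m + 1)} {M : ℝ}
    (hM : ∀ p ∈ V, ChartBounded j M (f p)) : IsHolomorphicOnP V f := by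
  refine isHolomorphicOnP_of_projRatio hV (fun p hp => (hM p hp).rep_ne_zero)
    fun p hp => DifferentiableAt.differentiableWithinAt ?_
  obtain ⟨δ, hδ, hsub⟩ := Metric.isOpen_iff.1 hV p hp
  have hmem : ∀ x ∈ ball p.1 δ, ∀ t ∈ ball p.2 δ, (x, t) ∈ V := fun x hx t ht =>
    hsub (by rw [← ball_prod_same]; exact ⟨hx, ht⟩)
  refine differentiableAt_of_separately_of_bounded (x₀ := p.1) (t₀ := p.2)
    (u := fun p => projRatio j (f p)) (M := M) hδ ?_ ?_ ?_
  · exact fun t htδ x hxδ => ((hx t).differentiableAt_projRatio (hΩ.preimage (by fun_prop))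
      (hVΩ (hmem x hxδ t htδ)) (hM _ (hmem x hxδ t htδ)).rep_ne_zero).differentiableWithinAt
  · exact fun x hxδ t htδ => ((ht x).differentiableAt_projRatio (hΩ.preimage (by fun_prop))
      (hVΩ (hmem x hxδ t htδ)) (hM _ (hmem x hxδ t htδ)).rep_ne_zero).differentiableWithinAt
  · intro x hxδ t htδ
    have h := hM _ (hmem x hxδ t htδ)
    exact (pi_norm_le_iff_of_nonneg (zero_le_one.trans h.one_le)).2 h.norm_projRatio_le

end Local

section Core

variable {m d : ℕ} {f : ℂ × ℂ × (Fin d → ℂ) → Projectivization ℂ (Fin (m + 1) → ℂ)}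
  {Ω : Set (ℂ × ℂ × (Fin d → ℂ))}

/-- The chart bound on a thin neighbourhood of `{c} × {0}` spreads to a disc of larger radius
on which the map is controlled along `w = 0`. -/
theorem exists_chartBounded_of_two_slices (hΩ : IsOpen Ω)
    (hA : ∀ y, IsHolomorphicOnP {p : ℂ × ℂ | (p.1, p.2, y) ∈ Ω} fun p => f (p.1, p.2, y))
    (hC : ∀ x, IsHolomorphicOnP {t | (x, t) ∈ Ω} fun t => f (x, t)) {c : ℂ} {ε R R' R'' : ℝ}
    (hε : 0 < ε) (hεR : ε ≤ R) (hR'' : 0 < R'') (hR''R' : R'' < R') (hR'R : R' < R)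
    (hsub : ∀ x ∈ closedBall c R, ∀ t ∈ ball (0 : ℂ × (Fin d → ℂ)) ε, (x, t) ∈ Ω)
    {j : Fin (m + 1)} {M M' : ℝ} (hMM' : M < M')
    (hM : ∀ x ∈ closedBall c R, ∀ y ∈ ball (0 : Fin d → ℂ) ε, ChartBounded j M (f (x, 0, y)))
    (hM' : ∀ x ∈ ball c ε, ∀ t ∈ ball (0 : ℂ × (Fin d → ℂ)) ε, ChartBounded j M' (f (x, t))) :
    ∃ δ > 0, ∃ B, ∀ x ∈ ball c R'', ∀ t ∈ ball (0 : ℂ × (Fin d → ℂ)) δ,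
      ChartBounded j B (f (x, t)) := by
  have hR' : 0 < R' := hR''.trans hR''R'
  have hR : 0 < R := hR'.trans hR'R
  have hx : ∀ t : ℂ × (Fin d → ℂ), IsHolomorphicOnP {x | (x, t) ∈ Ω} fun x => f (x, t) :=
    fun t => (hA t.2).comp (φ := fun x => (x, t.1)) (by fun_prop) fun _ h => h
  have hM'0 : 0 < M' := zero_lt_one.trans_le
    (hM' c (mem_ball_self hε) 0 (mem_ball_self hε)).one_le
  have hballs : ball c ε ⊆ closedBall c R := (ball_subset_ball hεR).trans ball_subset_closedBall
  have hpair : ∀ {τ : ℝ} {w : ℂ} {y : Fin d → ℂ}, τ ≤ ε → w ∈ ball 0 τ → y ∈ ball 0 ε →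
      (w, y) ∈ ball (0 : ℂ × (Fin d → ℂ)) ε := by
    intro τ w y hτ hw hy
    rw [← Prod.mk_zero_zero, ← ball_prod_same]
    exact ⟨ball_subset_ball hτ hw, hy⟩
  let τ : ℕ → ℝ := fun N => ε / (N + 1)
  have hτ0 : ∀ N, 0 < τ N := fun N => by positivity
  have hτε : ∀ N, τ N ≤ ε := fun N => div_le_self hε.le (by linarith [N.cast_nonneg (α := ℝ)])
  have hτlim : Tendsto τ atTop (𝓝 0) :=
    (tendsto_atTop_add_const_right _ _ tendsto_natCast_atTop_atTop).const_div_atTop ε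
  let C : ℕ → Set (Fin d → ℂ) := fun N => ⋂ x ∈ closedBall c R, ⋂ w ∈ ball (0 : ℂ) (τ N),
    {y | y ∈ ball 0 ε → ChartBounded j M' (f (x, w, y))}
  have hCcl : ∀ N, IsClosed (C N) := fun N => isClosed_biInter fun x hxR =>
    isClosed_biInter fun w hw => IsHolomorphicOnP.isClosed_setOf_chartBounded
      ((hC x).comp (φ := fun y => (w, y)) (S' := {y | (x, w, y) ∈ Ω}) (by fun_prop) fun _ h => h)
      (hΩ.preimage (by fun_prop)) isOpen_ball (fun y hy => hsub x hxR _ (hpair (hτε N) hw hy)) j M'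
  have hCmono : Monotone C := by
    intro N N' hNN' y hy
    refine mem_iInter₂.2 fun x hxR => mem_iInter₂.2 fun w hw => ?_
    refine mem_iInter₂.1 (mem_iInter₂.1 hy x hxR) w (ball_subset_ball ?_ hw)
    simp only [τ]
    gcongr
  have hcover : ball (0 : Fin d → ℂ) ε ⊆ ⋃ N, C N := by
    intro y hy
    obtain ⟨δ, hδ, hδM⟩ := (hA y).exists_chartBounded_tube (hΩ.preimage (by fun_prop))
      (isCompact_closedBall c R)
      (fun x hxR => hsub x hxR _ (hpair le_rfl (mem_ball_self hε) hy)) hMM'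
      (fun x hxR => hM x hxR y hy)
    obtain ⟨N, hN⟩ := (hτlim.eventually (gt_mem_nhds hδ)).exists
    exact mem_iUnion.2 ⟨N, mem_iInter₂.2 fun x hxR => mem_iInter₂.2 fun w hw _ =>
      hδM x hxR w (ball_subset_ball hN.le hw)⟩
  obtain ⟨N, hN⟩ := exists_volume_diff_mul_le (B := ball (0 : Fin d → ℂ) ε) measurableSet_ball
    measure_ball_lt_top.ne (fun N => (hCcl N).measurableSet) hCmono hcover
    (A := ENNReal.ofReal (Real.log (R / (ε / 2))))
    (D := volume (ball (0 : Fin d → ℂ) (ε / 2)) * ENNReal.ofReal (Real.log (R / R')))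
    ENNReal.ofReal_ne_top (ENNReal.mul_pos (measure_ball_pos _ _ (by positivity)).ne'
      (ENNReal.ofReal_pos.2 (Real.log_pos ((one_lt_div hR').2 hR'R))).ne')
  have hdx : ∀ t ∈ ball (0 : ℂ × (Fin d → ℂ)) ε, ∀ l,
      DifferentiableOn ℂ (fun x => projRatio j (f (x, t)) l) (ball c ε) :=
    fun t ht l x hxε => (differentiableAt_pi.1 ((hx t).differentiableAt_projRatio
      (hΩ.preimage (by fun_prop)) (hsub x (hballs hxε) t ht)
      (hM' x hxε t ht).rep_ne_zero) l).differentiableWithinAt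
  have hdt : ∀ x ∈ ball c ε, ∀ l,
      DifferentiableOn ℂ (fun t => projRatio j (f (x, t)) l) (ball 0 ε) :=
    fun x hxε l t ht => (differentiableAt_pi.1 ((hC x).differentiableAt_projRatio
      (hΩ.preimage (by fun_prop)) (hsub x (hballs hxε) t ht)
      (hM' x hxε t ht).rep_ne_zero) l).differentiableWithinAt
  have hhalf : closedBall c (ε / 2) ⊆ ball c ε := closedBall_subset_ball (by linarith)
  have hcoef : ∀ i l, ∀ w ∈ ball (0 : ℂ) (τ N / 2), ∀ y ∈ ball (0 : Fin d → ℂ) (ε / 2),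
      ‖iteratedDeriv i (fun x => projRatio j (f (x, w, y)) l) c / i.factorial‖ ≤ M' / R' ^ i := by
    intro i l
    refine norm_le_div_pow_of_volume_diff_le (Z := C N ∩ ball 0 ε) (ρ := ε / 2)
      (b := fun t => iteratedDeriv i (fun x => projRatio j (f (x, t)) l) c / i.factorial)
      (hτε N) (hτ0 N) (by positivity)
      (by linarith) hR' hR'R.le hM'0 ((hCcl N).measurableSet.inter measurableSet_ball)
      (by rwa [sdiff_inter_self_eq_sdiff]) ?_ i ?_ ?_
    · exact lineHolomorphicOn_iteratedDeriv isOpen_ball hε (fun t ht => hdx t ht l)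
        (fun x hx => hdt x hx l) (fun x hx t ht => (hM' x hx t ht).norm_projRatio_le l) i
    · exact fun t ht => norm_iteratedDeriv_div_factorial_le (by positivity)
        ((hdx t ht l).mono hhalf)
        (fun x hx => (hM' x (hhalf hx) t ht).norm_projRatio_le l) i
    · rintro w hw y ⟨hyC, hy⟩
      have hcb : ∀ x ∈ closedBall c R, ChartBounded j M' (f (x, w, y)) := fun x hxR =>
        mem_iInter₂.1 (mem_iInter₂.1 hyC x hxR) w hw hy
      refine norm_iteratedDeriv_div_factorial_le hR (fun x hxR => ?_)
        (fun x hxR => (hcb x hxR).norm_projRatio_le l) i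
      exact (differentiableAt_pi.1 ((hx (w, y)).differentiableAt_projRatio
        (hΩ.preimage (by fun_prop)) (hsub x hxR _ (hpair (hτε N) hw hy))
        (hcb x hxR).rep_ne_zero) l).differentiableWithinAt
  have hN2 := half_pos (hτ0 N)
  refine ⟨τ N / 2, hN2, M' * (1 - R'' / R')⁻¹, fun x hxb t ht => ?_⟩
  have htε : t ∈ ball (0 : ℂ × (Fin d → ℂ)) ε := ball_subset_ball (by linarith [hτε N]) ht
  have ht' : t.1 ∈ ball (0 : ℂ) (τ N / 2) ∧ t.2 ∈ ball (0 : Fin d → ℂ) (τ N / 2) := by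
    rwa [← Prod.mk_zero_zero, ← ball_prod_same] at ht
  refine IsHolomorphicOnP.chartBounded_of_taylor (h := fun x => f (x, t)) hε hR'' hR''R' ?_
    (hdx t htε) (fun x hx => hM' x hx t htε) (fun i l => hcoef i l t.1 ht'.1 t.2
      (ball_subset_ball (by linarith [hτε N]) ht'.2)) x hxb
  exact IsHolomorphicOnP.comp (hx t) (φ := id) differentiable_id fun x hx =>
    hsub x (closedBall_subset_closedBall (hR''R'.trans hR'R).le (ball_subset_closedBall hx)) t htε

theorem exists_isHolomorphicOnP_nhds_zero (hΩ : IsOpen Ω) (h0 : 0 ∈ Ω)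
    (hA : ∀ y, IsHolomorphicOnP {p : ℂ × ℂ | (p.1, p.2, y) ∈ Ω} fun p => f (p.1, p.2, y))
    (hB : ∀ w, IsHolomorphicOnP {p : ℂ × (Fin d → ℂ) | (p.1, w, p.2) ∈ Ω}
      fun p => f (p.1, w, p.2))
    (hC : ∀ x, IsHolomorphicOnP {t | (x, t) ∈ Ω} fun t => f (x, t)) :
    ∃ V, IsOpen V ∧ 0 ∈ V ∧ IsHolomorphicOnP V f := by
  obtain ⟨j, hj⟩ := exists_chartBounded (f 0)
  have hev := (hB 0).eventually_chartBounded (p := 0) (hΩ.preimage (by fun_prop)) h0 hj one_lt_two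
  obtain ⟨r₁, hr₁, hr₁M⟩ := Metric.eventually_nhds_iff_ball.1 hev
  obtain ⟨r₂, hr₂, hr₂Ω⟩ := Metric.isOpen_iff.1 hΩ 0 h0
  obtain ⟨r, hr, hr1, hr2⟩ : ∃ r > 0, 4 * r ≤ r₁ ∧ 4 * r ≤ r₂ :=
    ⟨min r₁ r₂ / 4, by positivity, by linarith [min_le_left r₁ r₂],
      by linarith [min_le_right r₁ r₂]⟩
  have hsub : ∀ x ∈ ball (0 : ℂ) (4 * r), ∀ t ∈ ball (0 : ℂ × (Fin d → ℂ)) (4 * r),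
      (x, t) ∈ Ω := by
    intro x hx t ht
    refine hr₂Ω (ball_subset_ball hr2 ?_)
    rw [← Prod.mk_zero_zero, ← ball_prod_same]
    exact ⟨hx, ht⟩
  have hM : ∀ x ∈ ball (0 : ℂ) (4 * r), ∀ y ∈ ball (0 : Fin d → ℂ) (4 * r),
      ChartBounded j 2 (f (x, 0, y)) := by
    intro x hx y hy
    refine hr₁M (x, y) (ball_subset_ball hr1 ?_)
    rw [← Prod.mk_zero_zero, ← ball_prod_same]
    exact ⟨hx, hy⟩
  have h4 : ∀ {E : Type} [NormedAddCommGroup E], ball (0 : E) r ⊆ ball 0 (4 * r) :=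
    fun {_} [_] => ball_subset_ball (by linarith)
  have hx : ∀ t : ℂ × (Fin d → ℂ), IsHolomorphicOnP {x | (x, t) ∈ Ω} fun x => f (x, t) :=
    fun t => (hA t.2).comp (φ := fun x => (x, t.1)) (by fun_prop) fun _ h => h
  obtain ⟨c, hc, ε, hε, hεr, hcε, hM'⟩ := exists_ball_chartBounded hΩ hx hC hr
    (fun x hx t ht => hsub x (h4 hx) t (h4 ht)) (show (2 : ℝ) < 3 by norm_num)
    (fun x hx => hM x (h4 hx) 0 (mem_ball_self (by positivity)))
  rw [mem_ball_zero_iff] at hc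
  have hcR : closedBall c (2 * r) ⊆ ball 0 (4 * r) := by
    refine closedBall_subset_ball' ?_
    rw [dist_zero_right]
    linarith
  obtain ⟨δ, hδ, B, hδB⟩ := exists_chartBounded_of_two_slices hΩ hA hC (c := c) (ε := ε)
    (R := 2 * r) (R' := 3 / 2 * r) (R'' := 5 / 4 * r) hε (by linarith) (by linarith) (by linarith)
    (by linarith) (fun x hx t ht => hsub x (hcR hx) t (ball_subset_ball (by linarith) ht))
    (show (2 : ℝ) < 3 by norm_num)
    (fun x hx y hy => hM x (hcR hx) y (ball_subset_ball (by linarith) hy)) hM'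
  refine ⟨(ball c (5 / 4 * r) ×ˢ ball 0 δ) ∩ Ω, (isOpen_ball.prod isOpen_ball).inter hΩ,
    ⟨⟨?_, mem_ball_self hδ⟩, h0⟩, ?_⟩
  · rw [Prod.fst_zero, mem_ball, dist_zero_left]
    linarith
  · exact isHolomorphicOnP_of_separately hΩ hx hC ((isOpen_ball.prod isOpen_ball).inter hΩ)
      inter_subset_right fun p hp => hδB p.1 hp.1.1 p.2 hp.1.2

theorem isHolomorphicOnP_of_slices (hΩ : IsOpen Ω)
    (hA : ∀ y, IsHolomorphicOnP {p : ℂ × ℂ | (p.1, p.2, y) ∈ Ω} fun p => f (p.1, p.2, y))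
    (hB : ∀ w, IsHolomorphicOnP {p : ℂ × (Fin d → ℂ) | (p.1, w, p.2) ∈ Ω}
      fun p => f (p.1, w, p.2))
    (hC : ∀ x, IsHolomorphicOnP {t | (x, t) ∈ Ω} fun t => f (x, t)) :
    IsHolomorphicOnP Ω f := by
  intro a ha
  obtain ⟨V, hV, h0V, hhol⟩ := exists_isHolomorphicOnP_nhds_zero
    (f := fun p => f (p.1 + a.1, p.2.1 + a.2.1, p.2.2 + a.2.2))
    (Ω := {p | (p.1 + a.1, p.2.1 + a.2.1, p.2.2 + a.2.2) ∈ Ω}) (hΩ.preimage (by fun_prop))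
    (by simpa using ha)
    (fun y => (hA (y + a.2.2)).comp (φ := fun p : ℂ × ℂ => (p.1 + a.1, p.2 + a.2.1)) (by fun_prop)
      fun _ h => h)
    (fun w => (hB (w + a.2.1)).comp (φ := fun p : ℂ × (Fin d → ℂ) => (p.1 + a.1, p.2 + a.2.2)) (by fun_prop)
      fun _ h => h)
    (fun x => (hC (x + a.1)).comp (φ := fun t : ℂ × (Fin d → ℂ) => (t.1 + a.2.1, t.2 + a.2.2)) (by fun_prop)
      fun _ h => h)
  have h := hhol.comp (φ := fun p => p - a) (S' := {p | p - a ∈ V}) (by fun_prop) fun _ h => h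
  obtain ⟨U, hU, haU, F, hF, hd, he⟩ := h a (by simpa using h0V)
  have hVa : IsOpen {p | p - a ∈ V} := hV.preimage (f := fun p => p - a) (by fun_prop)
  refine ⟨U ∩ {p | p - a ∈ V}, hU.inter hVa, ⟨haU, by simpa using h0V⟩, F,
    fun w hw => hF w hw.1, hd.mono inter_subset_left, fun w hw _ => ?_⟩
  rw [← he w hw.1 hw.2]
  simp

end Core

section CoordinatePlanes

variable {m : ℕ}

theorem differentiable_insertNth {n : ℕ} (j : Fin (n + 1)) (c : ℂ) :
    Differentiable ℂ fun z : Fin n → ℂ => (j.insertNth c z : Fin (n + 1) → ℂ) := by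
  refine differentiable_pi.2 fun i => ?_
  rcases Fin.eq_self_or_eq_succAbove j i with rfl | ⟨k, rfl⟩
  · simp only [Fin.insertNth_apply_same]
    fun_prop
  · simp only [Fin.insertNth_apply_succAbove]
    fun_prop

theorem differentiable_vecCons {E : Type*} [NormedAddCommGroup E] [NormedSpace ℂ E] {n : ℕ}
    {a : E → ℂ} {b : E → Fin n → ℂ} (ha : Differentiable ℂ a) (hb : Differentiable ℂ b) :
    Differentiable ℂ fun p => Matrix.vecCons (a p) (b p) := by
  refine differentiable_pi.2 fun i => ?_
  cases i using Fin.cases with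
  | zero => simpa using ha
  | succ i => simpa using differentiable_pi.1 hb i

/-- The restriction of `f` to a coordinate hyperplane is holomorphic along coordinate planes. -/
theorem isHolomorphicOnP_insertNth {d : ℕ} {Ω : Set (Fin (d + 3) → ℂ)}
    {f : (Fin (d + 3) → ℂ) → Projectivization ℂ (Fin (m + 1) → ℂ)}
    (hf : ∀ P : Set (Fin (d + 3) → ℂ), IsCoordPlane (d + 3) 2 P → IsHolomorphicOnP (Ω ∩ P) f)
    (j : Fin (d + 3)) (c : ℂ) (P : Set (Fin (d + 2) → ℂ)) (hP : IsCoordPlane (d + 2) 2 P) :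
    IsHolomorphicOnP ({z | j.insertNth c z ∈ Ω} ∩ P) fun z => f (j.insertNth c z) := by
  classical
  obtain ⟨I, a, hI, rfl⟩ := hP
  have hcard : (insert j (I.map j.succAboveEmb)).card = d + 3 - 2 := by
    rw [Finset.card_insert_of_notMem (by simp [Fin.succAbove_ne]), Finset.card_map, hI]
    omega
  refine (hf _ ⟨_, j.insertNth c a, hcard, rfl⟩).comp (differentiable_insertNth j c) ?_
  rintro z ⟨hz, hzI⟩
  refine ⟨hz, fun i hi => ?_⟩
  rcases Fin.eq_self_or_eq_succAbove j i with rfl | ⟨k, rfl⟩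
  · simp
  · have hk : k ∈ I := by simpa [Fin.succAbove_ne] using hi
    simpa using hzI k hk

theorem isHolomorphicOnP_of_coordPlanes (d : ℕ) (Ω : Set (Fin (d + 2) → ℂ)) (hΩ : IsOpen Ω)
    (f : (Fin (d + 2) → ℂ) → Projectivization ℂ (Fin (m + 1) → ℂ))
    (hf : ∀ P : Set (Fin (d + 2) → ℂ), IsCoordPlane (d + 2) 2 P → IsHolomorphicOnP (Ω ∩ P) f) :
    IsHolomorphicOnP Ω f := by
  induction d with
  | zero => simpa using hf univ ⟨∅, 0, by simp, by simp⟩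
  | succ d ih =>
    have hcons : Differentiable ℂ fun p : ℂ × ℂ × (Fin (d + 1) → ℂ) =>
        Matrix.vecCons p.1 (Matrix.vecCons p.2.1 p.2.2) :=
      differentiable_vecCons (by fun_prop) (differentiable_vecCons (by fun_prop) (by fun_prop))
    have hplane : ∀ (j : Fin (d + 3)) (c : ℂ),
        IsHolomorphicOnP {z : Fin (d + 2) → ℂ | j.insertNth c z ∈ Ω}
          fun z => f (j.insertNth c z) := fun j c =>
      ih _ (hΩ.preimage (differentiable_insertNth j c).continuous) _
        (isHolomorphicOnP_insertNth hf j c)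
    have h0 : ∀ (x w : ℂ) (y : Fin (d + 1) → ℂ), Matrix.vecCons x (Matrix.vecCons w y) =
        (0 : Fin (d + 3)).insertNth (α := fun _ => ℂ) x (Matrix.vecCons w y) := fun x w y => by
      rw [Fin.insertNth_zero]; rfl
    have h1 : ∀ (x w : ℂ) (y : Fin (d + 1) → ℂ), Matrix.vecCons x (Matrix.vecCons w y) =
        (1 : Fin (d + 3)).insertNth (α := fun _ => ℂ) w (Matrix.vecCons x y) := fun x w y => by
      refine (Fin.insertNth_eq_iff.2 ⟨rfl, funext fun i => ?_⟩).symm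
      cases i using Fin.cases with
      | zero => rfl
      | succ i => rfl
    have hmain : IsHolomorphicOnP
        {p : ℂ × ℂ × (Fin (d + 1) → ℂ) | Matrix.vecCons p.1 (Matrix.vecCons p.2.1 p.2.2) ∈ Ω}
        fun p => f (Matrix.vecCons p.1 (Matrix.vecCons p.2.1 p.2.2)) := by
      refine isHolomorphicOnP_of_slices (hΩ.preimage hcons.continuous) (fun y => ?_)
        (fun w => ?_) fun x => ?_
      · refine (hf {z | ∀ i ∈ Finset.univ.map ((Fin.succEmb _).trans (Fin.succEmb _)),
          z i = Matrix.vecCons 0 (Matrix.vecCons 0 y) i} ⟨_, _, by simp, rfl⟩).comp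
          (φ := fun p : ℂ × ℂ => Matrix.vecCons p.1 (Matrix.vecCons p.2 y))
          (differentiable_vecCons (by fun_prop) (differentiable_vecCons (by fun_prop)
            (by fun_prop))) fun p hp => ⟨hp, ?_⟩
        simp
      · simp only [h1]
        exact (hplane 1 w).comp (φ := fun p : ℂ × (Fin (d + 1) → ℂ) => Matrix.vecCons p.1 p.2)
          (differentiable_vecCons (by fun_prop) (by fun_prop)) fun _ h => h
      · simp only [h0]
        exact (hplane 0 x).comp (φ := fun p : ℂ × (Fin (d + 1) → ℂ) => Matrix.vecCons p.1 p.2)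
          (differentiable_vecCons (by fun_prop) (by fun_prop)) fun _ h => h
    have hinv : ∀ z : Fin (d + 3) → ℂ,
        Matrix.vecCons (z 0) (Matrix.vecCons (z 1) fun i => z i.succ.succ) = z := fun z => by
      funext i
      cases i using Fin.cases with
      | zero => rfl
      | succ i =>
        cases i using Fin.cases with
        | zero => rfl
        | succ i => rfl
    have h := hmain.comp
      (φ := fun z : Fin (d + 3) → ℂ => (z 0, z 1, fun i : Fin (d + 1) => z i.succ.succ))
      (S' := Ω) (by fun_prop) fun z hz => by simpa only [mem_ofPred_eq, hinv] using hz
    simpa only [Function.comp_def, hinv] using h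

end CoordinatePlanes

/-- **Main Theorem.** If `n ≥ 3`, `Ω` is an open domain in `ℂⁿ`, and the restriction of
`f : Ω → ℙ^m` to `Ω ∩ Π²` is holomorphic for every coordinate 2-plane `Π²`, then `f` is
holomorphic on `Ω`. -/
theorem hartogs_for_projective_space (n m : ℕ) (hn : 3 ≤ n)
    (Ω : Set (Fin n → ℂ)) (hΩopen : IsOpen Ω) (hΩconn : IsConnected Ω)
    (f : (Fin n → ℂ) → Projectivization ℂ (Fin (m + 1) → ℂ))
    (hf : ∀ P : Set (Fin n → ℂ), IsCoordPlane n 2 P → IsHolomorphicOnP (Ω ∩ P) f) :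
    IsHolomorphicOnP Ω f := by
  obtain ⟨d, rfl⟩ := Nat.exists_eq_add_of_le' (show 2 ≤ n by omega)
  exact isHolomorphicOnP_of_coordPlanes d Ω hΩopen f hf
end

section
/- Let Ω be an open subset of ℂ^{n+1}, let r ≥ 1 be a fixed integer, and let A ⊆ Ω be a subset such that for every coordinate n-plane Πⁿ in ℂ^{n+1} the intersection A ∩ Πⁿ is either empty or an analytic subset of Ω ∩ Πⁿ of pure dimension r. Then A is closed in Ω. -/
/-- `A` is an analytic subset (subvariety) of `W ⊆ ℂᵏ`: every point of `W` has an open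
neighbourhood (inside `W`) on which `A` coincides with the common zero set of finitely
many holomorphic functions. -/
def IsAnalyticSubsetOf {k : ℕ} (W A : Set (Fin k → ℂ)) : Prop :=
  A ⊆ W ∧ ∀ z ∈ W, ∃ U : Set (Fin k → ℂ), IsOpen U ∧ z ∈ U ∧ U ⊆ W ∧
    ∃ (N : ℕ) (g : Fin N → ((Fin k → ℂ) → ℂ)),
      (∀ i, DifferentiableOn ℂ (g i) U) ∧
      A ∩ U = {w ∈ U | ∀ i, g i w = 0}

/-- `w` is a regular (smooth) point of `A ⊆ ℂᵏ` of dimension `d`: near `w` the set `A`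
is a `d`-dimensional complex submanifold, cut out by `k - d` holomorphic functions whose
derivative is surjective along `A`. -/
def IsRegularPointOfDim (k d : ℕ) (A : Set (Fin k → ℂ)) (w : Fin k → ℂ) : Prop :=
  d ≤ k ∧ ∃ V : Set (Fin k → ℂ), IsOpen V ∧ w ∈ V ∧
    ∃ g : (Fin k → ℂ) → (Fin (k - d) → ℂ),
      DifferentiableOn ℂ g V ∧
      (∀ v ∈ A ∩ V, Function.Surjective (fderiv ℂ g v)) ∧
      A ∩ V = {v ∈ V | g v = 0}

/-- The local dimension of `A ⊆ ℂᵏ` at `a` equals `r`: there are regular points of `A`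
of dimension `r` arbitrarily close to `a`, and `r` is the largest dimension with this
property. -/
def HasLocalDim (k : ℕ) (A : Set (Fin k → ℂ)) (a : Fin k → ℂ) (r : ℕ) : Prop :=
  (∀ V : Set (Fin k → ℂ), IsOpen V → a ∈ V →
    ∃ w ∈ A ∩ V, IsRegularPointOfDim k r A w) ∧
  ∀ d : ℕ, (∀ V : Set (Fin k → ℂ), IsOpen V → a ∈ V →
    ∃ w ∈ A ∩ V, IsRegularPointOfDim k d A w) → d ≤ r

/-- `A ⊆ ℂᵏ` has pure dimension `r`: at every point of `A` the local dimension of `A`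
equals `r`. -/
def HasPureDim (k : ℕ) (A : Set (Fin k → ℂ)) (r : ℕ) : Prop :=
  ∀ a ∈ A, HasLocalDim k A a r

section

open Metric MeasureTheory Topology Set Filter

theorem fderiv_apply_eq_circleIntegral {E : Type*} [NormedAddCommGroup E] [NormedSpace ℂ E]
    {f : E → ℂ} {W : Set E} (hW : IsOpen W) (hf : DifferentiableOn ℂ f W) {z v : E} {ρ : ℝ}
    (hρ : 0 < ρ) (hz : ∀ t ∈ closedBall (0 : ℂ) ρ, z + t • v ∈ W) :
    fderiv ℂ f z v =
      (2 * Real.pi * Complex.I : ℂ)⁻¹ • ∮ t in C(0, ρ), ((t - 0) ^ 2)⁻¹ • f (z + t • v) := by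
  have hline : Continuous fun t : ℂ ↦ z + t • v := by fun_prop
  have hcauchy := Complex.two_pi_I_inv_smul_circleIntegral_sub_sq_inv_smul_of_differentiable
    (f := fun t : ℂ ↦ f (z + t • v)) (hW.preimage hline) (fun t ht ↦ hz t ht)
    (hf.comp (by fun_prop) fun t ht ↦ ht) (mem_ball_self hρ)
  rw [hcauchy]
  have hzW : z ∈ W := by simpa using hz 0 (by simp [hρ.le])
  exact ((hf.differentiableAt (hW.mem_nhds hzW)).hasFDerivAt.hasLineDerivAt v).deriv.symm

theorem differentiableOn_fderiv_apply {n : ℕ} {U : Set (Fin n → ℂ)} (hU : IsOpen U)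
    {f : (Fin n → ℂ) → ℂ} (hf : DifferentiableOn ℂ f U) (v : Fin n → ℂ) :
    DifferentiableOn ℂ (fun z ↦ fderiv ℂ f z v) U := by
  intro z₀ hz₀
  apply DifferentiableAt.differentiableWithinAt
  obtain ⟨R, hR, hRU⟩ := Metric.nhds_basis_closedBall.mem_iff.1 (hU.mem_nhds hz₀)
  obtain ⟨M, hM⟩ := (isCompact_closedBall z₀ R).exists_bound_of_continuousOn
    (hf.continuousOn.mono hRU)
  obtain ⟨ρ, hρ, hρv⟩ : ∃ ρ : ℝ, 0 < ρ ∧ ρ * ‖v‖ < R / 3 := by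
    refine ⟨R / (3 * (‖v‖ + 1)), by positivity, ?_⟩
    rw [div_mul_eq_mul_div, div_lt_div_iff₀ (by positivity) (by norm_num)]
    nlinarith [norm_nonneg v]
  have hmem : ∀ z ∈ ball z₀ (R / 3), ∀ t ∈ closedBall (0 : ℂ) ρ,
      z + t • v ∈ ball z₀ (2 * R / 3) := by
    intro z hz t ht
    rw [mem_ball, dist_eq_norm] at hz ⊢
    rw [mem_closedBall, dist_zero_right] at ht
    calc ‖z + t • v - z₀‖ = ‖(z - z₀) + t • v‖ := by congr 1; abel
      _ ≤ ‖z - z₀‖ + ‖t‖ * ‖v‖ := (norm_add_le _ _).trans (by rw [norm_smul])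
      _ < R / 3 + R / 3 := by
        have := mul_le_mul_of_nonneg_right ht (norm_nonneg v)
        linarith
      _ = 2 * R / 3 := by ring
  have hdiff : ∀ y ∈ ball z₀ (2 * R / 3), DifferentiableAt ℂ f y := fun y hy ↦
    hf.differentiableAt (hU.mem_nhds (hRU (ball_subset_closedBall
      (ball_subset_ball (by linarith) hy))))
  have hbound : ∀ y ∈ ball z₀ (2 * R / 3), ‖fderiv ℂ f y‖ ≤ 2 * M / (R / 3) := by
    intro y hy
    have hsub : ball y (R / 3) ⊆ closedBall z₀ R := fun x hx ↦ by
      rw [mem_ball] at hx hy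
      rw [mem_closedBall]
      linarith [dist_triangle x y z₀]
    refine Complex.norm_fderiv_le_div_of_mapsTo_ball (hf.mono (hsub.trans hRU)) ?_ (by positivity)
    intro x hx
    rw [mem_closedBall, dist_eq_norm]
    have h1 := hM x (hsub hx)
    have h2 := hM y (hsub (mem_ball_self (by positivity)))
    linarith [norm_sub_le (f x) (f y)]
  have hcm : ∀ θ : ℝ, circleMap 0 ρ θ ∈ closedBall (0 : ℂ) ρ := fun θ ↦
    circleMap_mem_closedBall _ hρ.le _
  have hcm0 : ∀ θ : ℝ, circleMap 0 ρ θ ≠ 0 := fun θ ↦ circleMap_ne_center hρ.ne'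
  set k : ℝ → ℂ := fun θ ↦ deriv (circleMap 0 ρ) θ * ((circleMap 0 ρ θ - 0) ^ 2)⁻¹ with hk
  have hkc : Continuous k := by
    refine Continuous.mul ?_ (Continuous.inv₀ (by fun_prop) fun θ ↦ by simpa using hcm0 θ)
    rw [show deriv (circleMap 0 ρ) = fun θ ↦ circleMap 0 ρ θ * Complex.I from
      funext (deriv_circleMap 0 ρ)]
    fun_prop
  have hkn : ∀ θ, ‖k θ‖ ≤ ρ⁻¹ := fun θ ↦ by
    simp only [hk, deriv_circleMap, norm_mul, norm_inv, norm_pow, sub_zero, norm_circleMap_zero,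
      abs_of_pos hρ, Complex.norm_I, mul_one]
    apply le_of_eq
    field_simp
  have hFc : ∀ z ∈ ball z₀ (R / 3), Continuous fun θ ↦ f (z + circleMap 0 ρ θ • v) := by
    intro z hz
    rw [continuous_iff_continuousAt]
    intro θ
    exact ContinuousAt.comp (f := fun θ ↦ z + circleMap 0 ρ θ • v)
      (hdiff _ (hmem z hz _ (hcm θ))).continuousAt (by fun_prop)
  have key := hasFDerivAt_integral_of_dominated_of_fderiv_le (𝕜 := ℂ)
    (μ := volume.restrict (Ioc 0 (2 * Real.pi)))
    (F := fun z θ ↦ k θ * f (z + circleMap 0 ρ θ • v))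
    (F' := fun z θ ↦ k θ • fderiv ℂ f (z + circleMap 0 ρ θ • v))
    (bound := fun _ ↦ ρ⁻¹ * (2 * M / (R / 3)))
    (ball_mem_nhds z₀ (by positivity : 0 < R / 3))
    (by
      filter_upwards [ball_mem_nhds z₀ (by positivity : 0 < R / 3)] with z hz
      exact (hkc.mul (hFc z hz)).aestronglyMeasurable)
    ((hkc.mul (hFc z₀ (mem_ball_self (by positivity)))).integrableOn_Ioc)
    (by
      refine hkc.aestronglyMeasurable.smul ?_
      have : SecondCountableTopology ((Fin n → ℂ) →L[ℂ] ℂ) := by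
        have : ProperSpace ((Fin n → ℂ) →L[ℂ] ℂ) := FiniteDimensional.proper ℂ _
        infer_instance
      have h1 : Measurable fun θ : ℝ ↦ fderiv ℂ f (z₀ + circleMap 0 ρ θ • v) :=
        (measurable_fderiv ℂ f).comp (by fun_prop : Continuous _).measurable
      exact h1.stronglyMeasurable.aestronglyMeasurable)
    (by
      refine Eventually.of_forall fun θ z hz ↦ ?_
      rw [norm_smul]
      exact mul_le_mul (hkn θ) (hbound _ (hmem z hz _ (hcm θ))) (norm_nonneg _) (by positivity))
    (integrable_const _)
    (by
      refine Eventually.of_forall fun θ z hz ↦ ?_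
      have := (hdiff _ (hmem z hz _ (hcm θ))).hasFDerivAt.comp z
        ((hasFDerivAt_id z).add_const (circleMap 0 ρ θ • v))
      exact this.const_mul (k θ))
  refine ((key.differentiableAt.const_smul (2 * Real.pi * Complex.I : ℂ)⁻¹)).congr_of_eventuallyEq ?_
  filter_upwards [ball_mem_nhds z₀ (by positivity : 0 < R / 3)] with z hz
  rw [fderiv_apply_eq_circleIntegral isOpen_ball (fun y hy ↦ (hdiff y hy).differentiableWithinAt)
    hρ (hmem z hz), circleIntegral,
    intervalIntegral.integral_of_le (by positivity)]
  simp [hk, mul_assoc]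

theorem contDiffAt_of_differentiableOn {n : ℕ} {U : Set (Fin n → ℂ)} (hU : IsOpen U)
    {f : (Fin n → ℂ) → ℂ} (hf : DifferentiableOn ℂ f U) {z : Fin n → ℂ} (hz : z ∈ U) :
    ContDiffAt ℂ 1 f z := by
  have : ContDiffOn ℂ 1 f U := by
    rw [show (1 : WithTop ℕ∞) = 0 + 1 by rfl, contDiffOn_succ_iff_fderiv_of_isOpen hU]
    refine ⟨hf, by simp, ?_⟩
    rw [contDiffOn_zero, continuousOn_clm_apply]
    exact fun v ↦ (differentiableOn_fderiv_apply hU hf v).continuousOn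
  exact this.contDiffAt (hU.mem_nhds hz)

theorem exists_analytic_curve_of_det_ne_zero {n m : ℕ} {U : Set (Fin n → ℂ)} (hU : IsOpen U)
    {T : Fin m → (Fin n → ℂ) → ℂ} (hT : ∀ i, DifferentiableOn ℂ (T i) U)
    {q : Fin n → ℂ} (hq : q ∈ U) {v : Fin m → Fin n → ℂ} (w : Fin n → ℂ)
    (hdet : (Matrix.of fun i j ↦ fderiv ℂ (T i) q (v j)).det ≠ 0) :
    ∃ x : ℂ → Fin m → ℂ, AnalyticAt ℂ x 0 ∧ x 0 = 0 ∧
      ∀ᶠ t in 𝓝 0, ∀ i, T i (q + ∑ j, x t j • v j + t • w) = T i q := by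
  let L : ℂ × (Fin m → ℂ) →L[ℂ] (Fin n → ℂ) :=
    ∑ j, ((ContinuousLinearMap.proj j).comp
      (ContinuousLinearMap.snd ℂ ℂ (Fin m → ℂ))).smulRight (v j) +
    (ContinuousLinearMap.fst ℂ ℂ (Fin m → ℂ)).smulRight w
  have hL : ∀ p : ℂ × (Fin m → ℂ), L p = ∑ j, p.2 j • v j + p.1 • w := fun p ↦ by simp [L]
  let f : ℂ × (Fin m → ℂ) → Fin m → ℂ := fun p i ↦ T i (q + L p)
  have hTq : ∀ i, ContDiffAt ℂ 1 (T i) (q + L (0, 0)) := fun i ↦ by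
    simpa [hL] using contDiffAt_of_differentiableOn hU (hT i) hq
  have hf : ContDiffAt ℂ 1 f (0, 0) := by
    rw [contDiffAt_pi]
    exact fun i ↦ (hTq i).comp (0, 0) (by fun_prop)
  have hf' : HasFDerivAt f (ContinuousLinearMap.pi fun i ↦ (fderiv ℂ (T i) q).comp L) (0, 0) := by
    rw [hasFDerivAt_pi]
    intro i
    have h1 : HasFDerivAt (T i) (fderiv ℂ (T i) q) (q + L (0, 0)) := by
      simpa [hL] using ((hT i).differentiableAt (hU.mem_nhds hq)).hasFDerivAt
    exact h1.comp (0, 0) (L.hasFDerivAt.const_add q)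
  have hinv : (fderiv ℂ f (0, 0) ∘L .inr ℂ ℂ (Fin m → ℂ)).IsInvertible := by
    rw [hf'.fderiv]
    set A := (ContinuousLinearMap.pi fun i ↦ (fderiv ℂ (T i) q).comp L) ∘L
      .inr ℂ ℂ (Fin m → ℂ) with hA
    have hinj : Function.Injective (A : (Fin m → ℂ) →ₗ[ℂ] (Fin m → ℂ)) := by
      rw [← LinearMap.ker_eq_bot, LinearMap.ker_eq_bot']
      intro x hx
      refine Matrix.eq_zero_of_mulVec_eq_zero hdet ?_
      ext i
      have := congrFun hx i
      simpa [hA, hL, Matrix.mulVec, dotProduct, mul_comm] using this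
    exact ⟨(LinearEquiv.ofInjectiveEndo _ hinj).toContinuousLinearEquiv, by ext; rfl⟩
  have hx0 := hf.implicitFunction_apply_self one_ne_zero hinv
  refine ⟨hf.implicitFunction one_ne_zero hinv, ?_, hx0, ?_⟩
  · rw [Complex.analyticAt_iff_eventually_differentiableAt]
    filter_upwards [(hf.contDiffAt_implicitFunction one_ne_zero hinv).eventually (by simp)]
      with t ht using ht.differentiableAt one_ne_zero
  · filter_upwards [hf.eventually_apply_implicitFunction one_ne_zero hinv] with t ht i
    have h0 : f (0, 0) i = T i q := by simp [f, hL]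
    have h1 := congrFun ht i
    rw [h0] at h1
    rw [add_assoc, ← h1]
    exact congrArg (fun y ↦ T i (q + y)) (hL (t, hf.implicitFunction one_ne_zero hinv t)).symm

theorem add_sum_smul_add_smul_ne {K M : Type*} [Field K] [AddCommGroup M] [Module K M] {m : ℕ}
    {v : Fin m → M} {w : M} (hw : w ∉ Submodule.span K (range v)) (q : M) (x : Fin m → K)
    {t : K} (ht : t ≠ 0) : q + ∑ j, x j • v j + t • w ≠ q := by
  intro h
  apply hw
  have h1 : w = (-t⁻¹) • ∑ j, x j • v j := by
    have h2 : t • w = -∑ j, x j • v j := by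
      rw [add_assoc, add_eq_left] at h
      exact (neg_eq_of_add_eq_zero_right h).symm
    rw [neg_smul, ← smul_neg, ← h2, inv_smul_smul₀ ht]
  rw [h1]
  exact Submodule.smul_mem _ _ (Submodule.sum_mem _ fun j _ ↦
    Submodule.smul_mem _ _ (Submodule.subset_span (mem_range_self j)))

theorem det_eq_mul_det_submatrix_succ {R : Type*} [CommRing R] {m : ℕ}
    (A : Matrix (Fin (m + 1)) (Fin (m + 1)) R) (y : Fin (m + 1) → R) (hy : y 0 = 1)
    (s : R) (h : A.mulVec y = Pi.single 0 s) :
    A.det = s * (A.submatrix Fin.succ Fin.succ).det := by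
  have h1 := Matrix.det_updateCol_sum A 0 y
  rw [hy, one_smul] at h1
  rw [← h1]
  have h2 : (fun k ↦ ∑ i, y i • A k i) = Pi.single 0 s := by
    rw [← h]
    ext k
    simp [Matrix.mulVec, dotProduct, mul_comm]
  rw [h2, Matrix.det_succ_column_zero, Fin.sum_univ_succ]
  simp
  congr 1

/-- The Jacobian determinant of the functions `f i` with respect to the directions `v j`. -/
noncomputable def jacobianMinor {n m : ℕ} (f : Fin m → (Fin n → ℂ) → ℂ) (v : Fin m → Fin n → ℂ)
    (z : Fin n → ℂ) : ℂ :=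
  (Matrix.of fun i j ↦ fderiv ℂ (f i) z (v j)).det

theorem differentiableOn_jacobianMinor {n m : ℕ} {U : Set (Fin n → ℂ)} (hU : IsOpen U)
    {f : Fin m → (Fin n → ℂ) → ℂ} (hf : ∀ i, DifferentiableOn ℂ (f i) U)
    (v : Fin m → Fin n → ℂ) : DifferentiableOn ℂ (jacobianMinor f v) U := by
  unfold jacobianMinor
  simp only [Matrix.det_apply, Matrix.of_apply]
  refine DifferentiableOn.fun_sum fun σ _ ↦ DifferentiableOn.const_smul ?_ _
  exact fun z hz ↦ (HasFDerivWithinAt.finsetProd fun i _ ↦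
    (differentiableOn_fderiv_apply hU (hf (σ i)) (v i) z hz).hasFDerivWithinAt).differentiableWithinAt

theorem eventually_eq_zero_of_jacobianMinor_mem {n m : ℕ} {U : Set (Fin n → ℂ)} (hU : IsOpen U)
    {F : Set ((Fin n → ℂ) → ℂ)} (hF : ∀ f ∈ F, DifferentiableOn ℂ f U)
    {q : Fin n → ℂ} (hq : q ∈ U) (hFq : ∀ f ∈ F, f q = 0)
    {T : Fin m → (Fin n → ℂ) → ℂ} (hT : ∀ i, T i ∈ F) {v : Fin m → Fin n → ℂ} {w : Fin n → ℂ}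
    (hdet : jacobianMinor T v q ≠ 0)
    (hminor : ∀ f ∈ F, jacobianMinor (Fin.cons f T) (Fin.cons w v) ∈ F)
    {x : ℂ → Fin m → ℂ} (hx : AnalyticAt ℂ x 0) (hx0 : x 0 = 0)
    (hTx : ∀ᶠ t in 𝓝 0, ∀ i, T i (q + ∑ j, x t j • v j + t • w) = T i q) :
    ∀ f ∈ F, ∀ᶠ t in 𝓝 0, f (q + ∑ j, x t j • v j + t • w) = 0 := by
  set φ : ℂ → Fin n → ℂ := fun t ↦ q + ∑ j, x t j • v j + t • w with hφ
  have hφ0 : φ 0 = q := by simp [hφ, hx0]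
  have hxd : ∀ᶠ t in 𝓝 0, DifferentiableAt ℂ x t :=
    hx.eventually_analyticAt.mono fun t ht ↦ ht.differentiableAt
  have hφ' : ∀ᶠ t in 𝓝 0, HasDerivAt φ (∑ j, deriv x t j • v j + w) t := by
    filter_upwards [hxd] with t ht
    have h1 : ∀ j, HasDerivAt (fun t ↦ x t j) (deriv x t j) t := hasDerivAt_pi.1 ht.hasDerivAt
    have h2 : HasDerivAt (fun t ↦ ∑ j, x t j • v j) (∑ j, deriv x t j • v j) t :=
      HasDerivAt.fun_sum fun j _ ↦ (h1 j).smul_const (v j)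
    simpa using (h2.const_add q).fun_add ((hasDerivAt_id t).smul_const w)
  have hφc : ContinuousAt φ 0 := hφ'.self_of_nhds.continuousAt
  have hφU : ∀ᶠ t in 𝓝 0, φ t ∈ U := hφc.preimage_mem_nhds (by rw [hφ0]; exact hU.mem_nhds hq)
  have hcomp : ∀ f : (Fin n → ℂ) → ℂ, DifferentiableOn ℂ f U → AnalyticAt ℂ (f ∘ φ) 0 := by
    intro f hf
    rw [Complex.analyticAt_iff_eventually_differentiableAt]
    filter_upwards [hφU, hφ'] with t htU ht
    exact (hf.differentiableAt (hU.mem_nhds htU)).comp t ht.differentiableAt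
  have hderiv : ∀ f : (Fin n → ℂ) → ℂ, DifferentiableOn ℂ f U → ∀ᶠ t in 𝓝 0,
      HasDerivAt (f ∘ φ) (fderiv ℂ f (φ t) (∑ j, deriv x t j • v j + w)) t := by
    intro f hf
    filter_upwards [hφU, hφ'] with t htU ht
    exact (hf.differentiableAt (hU.mem_nhds htU)).hasFDerivAt.comp_hasDerivAt t ht
  have hh := differentiableOn_jacobianMinor hU (fun i ↦ hF _ (hT i)) v
  have hrec : ∀ f ∈ F, jacobianMinor (Fin.cons f T) (Fin.cons w v) ∘ φ =ᶠ[𝓝 0]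
      deriv (f ∘ φ) * (jacobianMinor T v ∘ φ) := by
    intro f hf
    have hTd := eventually_all.2 fun i ↦ hderiv (T i) (hF _ (hT i))
    filter_upwards [hderiv f (hF f hf), hTd, hTx.eventually_nhds] with t hft hTt hTxt
    have hT0 : ∀ i, fderiv ℂ (T i) (φ t) (∑ j, deriv x t j • v j + w) = 0 := by
      intro i
      rw [← (hTt i).deriv]
      have : (T i ∘ φ) =ᶠ[𝓝 t] fun _ ↦ T i q := hTxt.mono fun s hs ↦ hs i
      rw [this.deriv_eq, deriv_const]
    simp only [Function.comp_apply, Pi.mul_apply]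
    rw [hft.deriv]
    refine det_eq_mul_det_submatrix_succ _ (Fin.cons 1 (deriv x t)) rfl _ ?_
    ext i
    refine Fin.cases ?_ (fun i ↦ ?_) i
    · simp [Matrix.mulVec, dotProduct, Fin.sum_univ_succ, mul_comm, add_comm]
    · simpa [Matrix.mulVec, dotProduct, Fin.sum_univ_succ, mul_comm, add_comm] using hT0 i
  have horder : ∀ k : ℕ, ∀ f ∈ F, (k : ℕ∞) ≤ analyticOrderAt (f ∘ φ) 0 := by
    intro k
    induction k with
    | zero => simp
    | succ k ih =>
      intro f hf
      have ha := hcomp f (hF f hf)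
      have h1 := ih _ (hminor f hf)
      have h0 : analyticOrderAt (jacobianMinor T v ∘ φ) 0 = 0 := by
        rw [(hcomp _ hh).analyticOrderAt_eq_zero]
        simpa [hφ0] using hdet
      rw [analyticOrderAt_congr (hrec f hf), analyticOrderAt_mul ha.deriv (hcomp _ hh), h0,
        add_zero] at h1
      have h2 := ha.analyticOrderAt_deriv_add_one
      simp only [Function.comp_apply, hφ0, hFq f hf, sub_zero] at h2
      rw [show analyticOrderAt (f ∘ φ) 0 = analyticOrderAt (fun t ↦ f (φ t)) 0 from rfl, ← h2]
      push_cast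
      gcongr
  intro f hf
  rw [← analyticOrderAt_eq_top (f := fun t ↦ f (φ t)), ENat.eq_top_iff_forall_ge]
  exact fun k ↦ horder k f hf

theorem accPt_of_hasPureDim {n r : ℕ} (hr : 1 ≤ r) {V : Set (Fin n → ℂ)} (hV : HasPureDim n V r)
    {q : Fin n → ℂ} (hq : q ∈ V) : AccPt q (𝓟 V) := by
  rw [accPt_iff_frequently_nhdsNE]
  intro hiso
  rw [eventually_nhdsWithin_iff, _root_.eventually_nhds_iff] at hiso
  obtain ⟨W, hW, hWo, hqW⟩ := hiso
  have hVW : ∀ z ∈ V ∩ W, z = q := fun z hz ↦ by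
    by_contra hne
    exact hW z hz.2 hne hz.1
  obtain ⟨q', hq', hrn, O, hO, hqO, g, hg, hsurj, hVO⟩ := (hV q hq).1 W hWo hqW
  obtain rfl := hVW q' hq'
  choose v hv using fun j : Fin (n - r) ↦ hsurj q' ⟨hq, hqO⟩ (Pi.single j 1)
  have hgi : ∀ i, DifferentiableOn ℂ (fun z ↦ g z i) O := fun i ↦ differentiableOn_pi.1 hg i
  have hdet : (Matrix.of fun i j ↦ fderiv ℂ (fun z ↦ g z i) q' (v j)).det ≠ 0 := by
    have : (Matrix.of fun i j ↦ fderiv ℂ (fun z ↦ g z i) q' (v j)) = 1 := by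
      ext i j
      rw [Matrix.of_apply, fderiv_apply (hg.differentiableAt (hO.mem_nhds hqO))]
      simp [hv, Matrix.one_apply, Pi.single_apply]
    simp [this]
  obtain ⟨w, hw⟩ : ∃ w, w ∉ Submodule.span ℂ (range v) := by
    by_contra! h
    have h1 := finrank_range_le_card (R := ℂ) v
    rw [Set.finrank, Submodule.eq_top_iff'.2 h, finrank_top] at h1
    simp at h1
    omega
  obtain ⟨x, hx, hx0, hTx⟩ := exists_analytic_curve_of_det_ne_zero hO hgi hqO w hdet
  set φ : ℂ → Fin n → ℂ := fun t ↦ q' + ∑ j, x t j • v j + t • w with hφ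
  have hφc : ContinuousAt φ 0 := by
    exact (continuousAt_const.add (tendsto_finsetSum _ fun j _ ↦
      ((continuous_apply j).continuousAt.comp hx.continuousAt).smul continuousAt_const)).add
      (continuousAt_id.smul continuousAt_const)
  have hφ0 : φ 0 = q' := by simp [hφ, hx0]
  have hmem : ∀ᶠ t in 𝓝 0, φ t ∈ O ∩ W :=
    hφc.preimage_mem_nhds (by rw [hφ0]; exact (hO.inter hWo).mem_nhds ⟨hqO, hqW⟩)
  have hgq : g q' = 0 := (hVO.subset ⟨hq, hqO⟩).2
  have hall : ∀ᶠ t in 𝓝[≠] (0 : ℂ), False := by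
    rw [eventually_nhdsWithin_iff]
    filter_upwards [hmem, hTx] with t ht hgt ht0
    refine add_sum_smul_add_smul_ne hw q' (x t) ht0 (hVW (φ t) ⟨?_, ht.2⟩)
    have : φ t ∈ V ∩ O := by
      rw [hVO]
      refine ⟨ht.1, funext fun i ↦ ?_⟩
      exact (hgt i).trans (congrFun hgq i)
    exact this.1
  exact hall.exists.elim fun _ h ↦ h

theorem exists_recenter_sum_norm_sq {n : ℕ} (b p : Fin n → ℂ) :
    ∃ L : (Fin n → ℂ) → ℂ, Differentiable ℂ L ∧
      ∀ z, ∑ k, ‖z k - b k‖ ^ 2 = (L z).re + ∑ k, ‖z k - p k‖ ^ 2 := by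
  refine ⟨fun z ↦ ∑ k, (2 * (starRingEnd ℂ) (p k - b k) * (z k - p k) +
    ((‖p k - b k‖ ^ 2 : ℝ) : ℂ)), by fun_prop, fun z ↦ ?_⟩
  rw [Complex.re_sum, ← Finset.sum_add_distrib]
  refine Finset.sum_congr rfl fun k _ ↦ ?_
  simp only [Complex.sq_norm, Complex.normSq_apply]
  simp
  ring

theorem exists_le_norm_sub_of_le_norm_sub {n : ℕ} {z p : Fin n → ℂ} {s : ℝ} (hs : 0 < s)
    (h : s ≤ ‖z - p‖) : ∃ k, s ≤ ‖z k - p k‖ := by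
  by_contra! hlt
  exact absurd ((pi_norm_lt_iff hs).2 hlt) (not_lt.2 h)

/-- A set cut out by holomorphic functions and having no isolated points obeys the maximum
principle for sums of the real part of a holomorphic function and a multiple of `‖z - b‖²`. -/
theorem le_of_forall_sphere_le {n : ℕ} {U V : Set (Fin n → ℂ)} (hU : IsOpen U) {N : ℕ}
    {g : Fin N → (Fin n → ℂ) → ℂ} (hg : ∀ i, DifferentiableOn ℂ (g i) U)
    (hV : V ∩ U = {w ∈ U | ∀ i, g i w = 0}) (hacc : ∀ q ∈ V, AccPt q (𝓟 V))
    {G : (Fin n → ℂ) → ℂ} (hG : DifferentiableOn ℂ G U) {η : ℝ} (hη : 0 < η) (b : Fin n → ℂ)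
    {p : Fin n → ℂ} (hp : p ∈ V) {s c : ℝ} (hs : 0 < s) (hsU : closedBall p s ⊆ U)
    (hc : ∀ z ∈ V ∩ sphere p s, (G z).re + η * ∑ k, ‖z k - b k‖ ^ 2 ≤ c) :
    (G p).re + η * ∑ k, ‖p k - b k‖ ^ 2 ≤ c := by
  by_contra! hpc
  set u : (Fin n → ℂ) → ℝ := fun z ↦ (G z).re + η * ∑ k, ‖z k - b k‖ ^ 2 with hu
  have huc : ContinuousOn u U := by
    have := hG.continuousOn
    fun_prop
  set V' : Set (Fin n → ℂ) := {z | z ∈ V ∩ ball p s ∧ c < u z} with hV'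
  have hV'U : V' ⊆ U := fun z hz ↦ hsU (ball_subset_closedBall hz.1.2)
  set F : Set ((Fin n → ℂ) → ℂ) := {f | DifferentiableOn ℂ f U ∧ ∀ z ∈ V', f z = 0} with hF
  let P : ℕ → Prop := fun m ↦ ∃ T : Fin m → (Fin n → ℂ) → ℂ, (∀ i, T i ∈ F) ∧
    ∃ v : Fin m → Fin n → ℂ, ∃ a ∈ V', jacobianMinor T v a ≠ 0
  have hzero : ∀ {m : ℕ} {T : Fin m → (Fin n → ℂ) → ℂ} {v : Fin m → Fin n → ℂ} {a : Fin n → ℂ},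
      jacobianMinor T v a ≠ 0 → ∀ y : Fin m → ℂ,
      (∀ i, fderiv ℂ (T i) a (∑ j, y j • v j) = 0) → y = 0 := by
    intro m T v a hdet y hy
    refine Matrix.eq_zero_of_mulVec_eq_zero hdet ?_
    ext i
    simpa [Matrix.mulVec, dotProduct, mul_comm] using hy i
  have hPn : ∀ m, P m → m ≤ n := by
    rintro m ⟨T, -, v, a, -, hdet⟩
    have hli : LinearIndependent ℂ v := by
      rw [Fintype.linearIndependent_iff]
      intro y hy
      exact congrFun (hzero hdet y fun i ↦ by rw [hy, map_zero])
    simpa using hli.fintype_card_le_finrank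
  obtain ⟨m, ⟨T, hT, v, a, ha, hdet⟩, hmax⟩ : ∃ m, P m ∧ ¬ P (m + 1) := by
    by_contra! h
    have hall : ∀ m, P m := fun m ↦ by
      induction m with
      | zero => exact ⟨Fin.elim0, fun i ↦ i.elim0, Fin.elim0, p,
          ⟨⟨hp, mem_ball_self hs⟩, hpc⟩, by simp [jacobianMinor]⟩
      | succ m ih => exact h m ih
    exact absurd (hPn _ (hall (n + 1))) (by omega)
  have hTd : ∀ i, DifferentiableOn ℂ (T i) U := fun i ↦ (hT i).1
  have hhd := differentiableOn_jacobianMinor hU hTd v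
  have hCeq : V ∩ closedBall p s = closedBall p s ∩ ⋂ i, (closedBall p s ∩ g i ⁻¹' {0}) := by
    ext z
    have h1 : z ∈ U → (z ∈ V ↔ ∀ i, g i z = 0) := fun hz ↦
      ⟨fun h ↦ (hV.subset ⟨h, hz⟩).2, fun h ↦ (hV.superset ⟨hz, h⟩).1⟩
    simp only [mem_inter_iff, mem_iInter, mem_preimage, mem_singleton_iff]
    constructor
    · exact fun h ↦ ⟨h.2, fun i ↦ ⟨h.2, (h1 (hsU h.2)).1 h.1 i⟩⟩
    · exact fun h ↦ ⟨(h1 (hsU h.1)).2 fun i ↦ (h.2 i).2, h.1⟩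
  have hC : IsCompact (V ∩ closedBall p s) := by
    rw [hCeq]
    refine (isCompact_closedBall p s).inter_right (isClosed_iInter fun i ↦ ?_)
    exact ((hg i).continuousOn.mono hsU).preimage_isClosed_of_isClosed isClosed_closedBall
      isClosed_singleton
  have hCU : V ∩ closedBall p s ⊆ U := inter_subset_right.trans hsU
  have haC : a ∈ V ∩ closedBall p s := ⟨ha.1.1, ball_subset_closedBall ha.1.2⟩
  obtain ⟨M, hM⟩ := hC.exists_bound_of_continuousOn (hhd.continuousOn.mono hCU)
  have hha : 0 < ‖jacobianMinor T v a‖ := norm_pos_iff.2 hdet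
  have hMa := hM a haC
  have hua : 0 < u a - c := sub_pos.2 ha.2
  obtain ⟨K, hK, hKa⟩ : ∃ K : ℝ, 0 < K ∧
      M * Real.exp (K * c) < ‖jacobianMinor T v a‖ * Real.exp (K * u a) := by
    refine ⟨M / ‖jacobianMinor T v a‖ / (u a - c), div_pos (div_pos (by linarith) hha) hua, ?_⟩
    set K := M / ‖jacobianMinor T v a‖ / (u a - c) with hKdef
    have h1 : K * u a = K * c + M / ‖jacobianMinor T v a‖ := by
      rw [hKdef]
      field_simp
      ring
    rw [h1, Real.exp_add]
    have h2 := Real.add_one_le_exp (M / ‖jacobianMinor T v a‖)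
    have h3 : M < ‖jacobianMinor T v a‖ * Real.exp (M / ‖jacobianMinor T v a‖) := by
      rw [← div_lt_iff₀' hha]
      linarith
    nlinarith [Real.exp_pos (K * c)]
  obtain ⟨q, hqC, hqmax⟩ := hC.exists_isMaxOn ⟨a, haC⟩
    (f := fun z ↦ ‖jacobianMinor T v z‖ * Real.exp (K * u z))
    ((hhd.continuousOn.norm.mul (Real.continuous_exp.comp_continuousOn
      (continuousOn_const.mul huc))).mono hCU)
  have hqU : q ∈ U := hCU hqC
  have hqgt := hKa.trans_le (hqmax haC)
  have hq0 : jacobianMinor T v q ≠ 0 := by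
    intro h0
    simp only [h0, norm_zero, zero_mul] at hqgt
    exact absurd hqgt (not_lt.2 (mul_nonneg (by linarith) (Real.exp_pos _).le))
  have hqc : c < u q := by
    by_contra! hle
    refine absurd hqgt (not_lt.2 (mul_le_mul (hM q hqC) ?_ (Real.exp_pos _).le (by linarith)))
    exact Real.exp_le_exp.2 (mul_le_mul_of_nonneg_left hle hK.le)
  have hqball : q ∈ ball p s := by
    rcases (mem_closedBall.1 hqC.2).lt_or_eq with h | h
    · exact h
    · exact absurd (hc q ⟨hqC.1, h⟩) (not_le.2 hqc)
  have hqV' : q ∈ V' := ⟨⟨hqC.1, hqball⟩, hqc⟩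
  have hnear : ∀ᶠ z in 𝓝 q, z ∈ V → z ∈ V' := by
    filter_upwards [isOpen_ball.mem_nhds hqball,
      (huc.continuousAt (hU.mem_nhds hqU)).eventually (lt_mem_nhds hqc)] with z h1 h2 h3
    exact ⟨⟨h3, h1⟩, h2⟩
  obtain ⟨w, hw⟩ : ∃ w, w ∉ Submodule.span ℂ (range v) := by
    by_contra! hspan
    let A : (Fin n → ℂ) →L[ℂ] (Fin m → ℂ) := ContinuousLinearMap.pi fun i ↦ fderiv ℂ (T i) q
    have hA : HasFDerivAt (fun z i ↦ T i z) A q := by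
      rw [hasFDerivAt_pi]
      exact fun i ↦ ((hTd i).differentiableAt (hU.mem_nhds hqU)).hasFDerivAt
    have hker : LinearMap.ker (A : (Fin n → ℂ) →ₗ[ℂ] (Fin m → ℂ)) = ⊥ := by
      rw [LinearMap.ker_eq_bot']
      intro z hz
      obtain ⟨y, rfl⟩ := (Submodule.mem_span_range_iff_exists_fun ℂ).1 (hspan z)
      have : y = 0 := hzero hq0 y fun i ↦ congrFun hz i
      simp [this]
    obtain ⟨κ, -, hκ⟩ := LinearMap.exists_antilipschitzWith _ hker
    have hne := hA.eventually_ne (c := 0) ⟨κ, hκ⟩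
    have hfreq := accPt_iff_frequently_nhdsNE.1 (hacc q hqC.1)
    obtain ⟨z, hzV, hzne, hznear⟩ :=
      (hfreq.and_eventually (hne.and (hnear.filter_mono nhdsWithin_le_nhds))).exists
    exact hzne (funext fun i ↦ (hT i).2 z (hznear hzV))
  obtain ⟨x, hx, hx0, hTx⟩ := exists_analytic_curve_of_det_ne_zero hU hTd hqU w hq0
  have hFφ := eventually_eq_zero_of_jacobianMinor_mem hU (F := F) (fun f hf ↦ hf.1) hqU
    (fun f hf ↦ hf.2 q hqV') hT hq0 (w := w) (fun f hf ↦ ⟨differentiableOn_jacobianMinor hU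
      (fun i ↦ by refine Fin.cases ?_ (fun i ↦ ?_) i; exacts [hf.1, hTd i]) _, fun z hz ↦ by
        by_contra hne
        exact hmax ⟨_, fun i ↦ by refine Fin.cases ?_ (fun i ↦ ?_) i; exacts [hf, hT i],
          _, z, hz, hne⟩⟩) hx hx0 hTx
  set φ : ℂ → Fin n → ℂ := fun t ↦ q + ∑ j, x t j • v j + t • w with hφ
  have hφ0 : φ 0 = q := by simp [hφ, hx0]
  have hφd : ∀ᶠ t in 𝓝 0, DifferentiableAt ℂ φ t := by
    filter_upwards [hx.eventually_analyticAt] with t ht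
    have := ht.differentiableAt
    fun_prop
  have hφc : ContinuousAt φ 0 := hφd.self_of_nhds.continuousAt
  have hφU : ∀ᶠ t in 𝓝 0, φ t ∈ U := hφc.preimage_mem_nhds (by rw [hφ0]; exact hU.mem_nhds hqU)
  have hφball : ∀ᶠ t in 𝓝 0, φ t ∈ ball p s :=
    hφc.preimage_mem_nhds (by rw [hφ0]; exact isOpen_ball.mem_nhds hqball)
  have hgφ : ∀ᶠ t in 𝓝 0, ∀ i, g i (φ t) = 0 := eventually_all.2 fun i ↦
    hFφ (g i) ⟨hg i, fun z hz ↦ (hV.subset ⟨hz.1.1, hV'U hz⟩).2 i⟩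
  have hφC : ∀ᶠ t in 𝓝 0, φ t ∈ V ∩ closedBall p s := by
    filter_upwards [hφU, hφball, hgφ] with t h1 h2 h3
    exact ⟨(hV.superset ⟨h1, h3⟩).1, ball_subset_closedBall h2⟩
  obtain ⟨L, hL, hLq⟩ := exists_recenter_sum_norm_sq b q
  set k : (Fin n → ℂ) → ℂ := fun z ↦
    jacobianMinor T v z * Complex.exp (K * (G z + η * L z)) with hk
  have hψ : ∀ z, ‖jacobianMinor T v z‖ * Real.exp (K * u z) =
      ‖k z‖ * Real.exp (K * η * ∑ j, ‖z j - q j‖ ^ 2) := by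
    intro z
    simp only [hk, hu, norm_mul, Complex.norm_exp]
    rw [mul_assoc, ← Real.exp_add, hLq z]
    congr 2
    simp
    ring
  have hQ : ∀ z : Fin n → ℂ, 0 ≤ K * η * ∑ j, ‖z j - q j‖ ^ 2 := fun z ↦ by positivity
  have hle : ∀ᶠ t in 𝓝 0, ‖k (φ t)‖ * Real.exp (K * η * ∑ j, ‖φ t j - q j‖ ^ 2) ≤ ‖k q‖ := by
    filter_upwards [hφC] with t ht
    have := hqmax ht
    simp only [Set.mem_ofPred_eq, hψ] at this
    simpa using this
  have hkd : ∀ᶠ t in 𝓝 0, DifferentiableAt ℂ (k ∘ φ) t := by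
    filter_upwards [hφU, hφd] with t h1 h2
    have h3 : DifferentiableOn ℂ k U := by fun_prop
    exact (h3.differentiableAt (hU.mem_nhds h1)).comp t h2
  have hconst := Complex.eventually_eq_of_isLocalMax_norm hkd (by
    filter_upwards [hle] with t ht
    simp only [Function.comp_apply, hφ0]
    exact (le_mul_of_one_le_right (norm_nonneg _) (Real.one_le_exp (hQ _))).trans ht)
  have hkq : 0 < ‖k q‖ := norm_pos_iff.2 (mul_ne_zero hq0 (Complex.exp_ne_zero _))
  have hall : ∀ᶠ t in 𝓝[≠] (0 : ℂ), False := by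
    rw [eventually_nhdsWithin_iff]
    filter_upwards [hle, hconst] with t h1 h2 ht0
    simp only [Function.comp_apply, hφ0] at h2
    rw [h2] at h1
    have h3 : Real.exp (K * η * ∑ j, ‖φ t j - q j‖ ^ 2) ≤ 1 := by
      by_contra! hgt
      exact absurd h1 (not_le.2 (lt_mul_of_one_lt_right hkq hgt))
    have h4 : ∑ j, ‖φ t j - q j‖ ^ 2 ≤ 0 := by
      rw [Real.exp_le_one_iff] at h3
      exact nonpos_of_mul_nonpos_right h3 (by positivity)
    refine add_sum_smul_add_smul_ne hw q (x t) ht0 (show φ t = q from funext fun j ↦ ?_)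
    have h5 := (Finset.sum_eq_zero_iff_of_nonneg fun j _ ↦ sq_nonneg ‖φ t j - q j‖).1
      (le_antisymm h4 (Finset.sum_nonneg fun j _ ↦ sq_nonneg _)) j (Finset.mem_univ j)
    simpa [sub_eq_zero] using h5
  exact hall.exists.elim fun _ h ↦ h

theorem not_isLocalMaxOn_re_add_sum_norm_sq {n : ℕ} {U V : Set (Fin n → ℂ)} (hU : IsOpen U) {N : ℕ}
    {g : Fin N → (Fin n → ℂ) → ℂ} (hg : ∀ i, DifferentiableOn ℂ (g i) U)
    (hV : V ∩ U = {w ∈ U | ∀ i, g i w = 0}) (hacc : ∀ q ∈ V, AccPt q (𝓟 V))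
    {G : (Fin n → ℂ) → ℂ} (hG : DifferentiableOn ℂ G U) {η : ℝ} (hη : 0 < η) (b : Fin n → ℂ)
    {p : Fin n → ℂ} (hp : p ∈ V) (hpU : p ∈ U) :
    ¬ IsLocalMaxOn (fun z ↦ (G z).re + η * ∑ k, ‖z k - b k‖ ^ 2) V p := by
  intro hmax
  rw [IsLocalMaxOn, IsMaxFilter, eventually_nhdsWithin_iff] at hmax
  obtain ⟨s, hs, hsub⟩ := nhds_basis_closedBall.mem_iff.1 (inter_mem (hU.mem_nhds hpU) hmax)
  obtain ⟨L, hL, hLp⟩ := exists_recenter_sum_norm_sq b p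
  have key := le_of_forall_sphere_le hU hg hV hacc (G := fun z ↦ G z + η * L z)
    (by fun_prop) (half_pos hη) p hp hs (fun z hz ↦ (hsub hz).1)
    (c := (G p).re + η * (L p).re - η / 2 * s ^ 2) (by
      intro z hz
      have h1 := (hsub (sphere_subset_closedBall hz.2)).2 hz.1
      obtain ⟨k, hk⟩ := exists_le_norm_sub_of_le_norm_sub hs
        (by rw [← dist_eq_norm]; exact hz.2.ge)
      have h2 : s ^ 2 ≤ ∑ k, ‖z k - p k‖ ^ 2 :=
        (pow_le_pow_left₀ hs.le hk 2).trans
          (Finset.single_le_sum (f := fun k ↦ ‖z k - p k‖ ^ 2) (fun _ _ ↦ sq_nonneg _)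
            (Finset.mem_univ k))
      simp only [hLp] at h1
      simp at h1 ⊢
      nlinarith)
  simp at key
  have := mul_pos hη (pow_pos hs 2)
  linarith

theorem integral_eq_integral_Ioi_smul_circleAverage {E : Type*} [NormedAddCommGroup E]
    [NormedSpace ℝ E] {f : ℂ → E} (hfm : StronglyMeasurable f) (hf : Integrable f) :
    ∫ w, f w = ∫ ρ in Ioi (0 : ℝ), (2 * Real.pi * ρ) • Real.circleAverage f 0 ρ := by
  have hint : IntegrableOn (fun p : ℝ × ℝ ↦ p.1 • f (Complex.polarCoord.symm p))
      (Ioi (0 : ℝ) ×ˢ Ioo (-Real.pi) Real.pi) := by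
    have hm : Measurable fun p : ℝ × ℝ ↦ Complex.polarCoord.symm p := by
      simp only [Complex.polarCoord_symm_apply]
      fun_prop
    refine ⟨(measurable_fst.stronglyMeasurable.smul
      (hfm.comp_measurable hm)).aestronglyMeasurable, ?_⟩
    rw [hasFiniteIntegral_iff_enorm]
    refine lt_of_eq_of_lt ?_ hf.2
    rw [← Complex.lintegral_comp_polarCoord_symm, polarCoord_target]
    refine setLIntegral_congr_fun (measurableSet_Ioi.prod measurableSet_Ioo) fun p hp ↦ ?_
    simp only [enorm_smul, smul_eq_mul]
    rw [Real.enorm_of_nonneg (le_of_lt hp.1)]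
  rw [← Complex.integral_comp_polarCoord_symm, polarCoord_target]
  rw [Measure.volume_eq_prod, setIntegral_prod _ hint]
  refine setIntegral_congr_fun measurableSet_Ioi fun ρ _ ↦ ?_
  have hper : Function.Periodic (fun θ ↦ f (circleMap 0 ρ θ)) (2 * Real.pi) := fun θ ↦ by
    simp [periodic_circleMap 0 ρ θ]
  have := hper.intervalIntegral_add_eq 0 (-Real.pi)
  rw [zero_add, show -Real.pi + 2 * Real.pi = Real.pi by ring] at this
  simp only [Real.circleAverage, integral_smul, this]
  rw [← integral_Ioc_eq_integral_Ioo,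
    ← intervalIntegral.integral_of_le (by linarith [Real.pi_pos]), smul_smul,
    show 2 * Real.pi * ρ * (2 * Real.pi)⁻¹ = ρ by field_simp]
  congr 1
  refine intervalIntegral.integral_congr fun θ _ ↦ ?_
  simp [circleMap, Complex.polarCoord_symm_apply, Complex.exp_mul_I]

theorem circleAverage_inv_sub_of_lt {z : ℂ} {ρ : ℝ} (hρ : 0 ≤ ρ) (h : ρ < ‖z‖) :
    Real.circleAverage (fun w ↦ (z - w)⁻¹) 0 ρ = z⁻¹ := by
  have hd : DifferentiableOn ℂ (fun w ↦ (z - w)⁻¹) (closedBall 0 |ρ|) := fun w hw ↦ by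
    have : z - w ≠ 0 := sub_ne_zero.2 fun hzw ↦ by
      rw [mem_closedBall_zero_iff, abs_of_nonneg hρ, ← hzw] at hw
      linarith
    fun_prop (disch := exact this)
  simpa using (hd.diffContOnCl_ball subset_rfl).circleAverage

theorem circleAverage_inv_sub_of_gt {z : ℂ} {ρ : ℝ} (h : ‖z‖ < ρ) :
    Real.circleAverage (fun w ↦ (z - w)⁻¹) 0 ρ = 0 := by
  have hρ : 0 < ρ := (norm_nonneg z).trans_lt h
  rw [Real.circleAverage_eq_circleIntegral hρ.ne']
  rcases eq_or_ne z 0 with rfl | h0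
  · have : (∮ w in C(0, ρ), (w - 0)⁻¹ • (0 - w)⁻¹) =
        ∮ w in C(0, ρ), (-1 : ℂ) • (w - 0) ^ (-2 : ℤ) :=
      circleIntegral.integral_congr hρ.le fun w hw ↦ by
        have hw0 : w ≠ 0 := ne_of_mem_sphere hw hρ.ne'
        simp only [sub_zero, zero_sub, smul_eq_mul]
        field_simp
    rw [this, circleIntegral.integral_smul, circleIntegral.integral_sub_zpow_of_ne (by norm_num),
      smul_zero, smul_zero]
  · have hz : z ∈ ball (0 : ℂ) ρ := mem_ball_zero_iff.2 h
    have hint : ∀ {a : ℂ}, a ∈ ball (0 : ℂ) ρ → CircleIntegrable (fun w ↦ (w - a)⁻¹) 0 ρ :=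
      fun {a} ha ↦ circleIntegrable_sub_inv_iff.2 <| Or.inr fun hs ↦ by
        rw [abs_of_pos hρ] at hs
        exact absurd (mem_sphere.1 hs) (mem_ball.1 ha).ne
    have : (∮ w in C(0, ρ), (w - 0)⁻¹ • (z - w)⁻¹) =
        ∮ w in C(0, ρ), z⁻¹ • ((w - 0)⁻¹ - (w - z)⁻¹) :=
      circleIntegral.integral_congr hρ.le fun w hw ↦ by
        have hw0 : w ≠ 0 := ne_of_mem_sphere hw hρ.ne'
        have hwz : w - z ≠ 0 := sub_ne_zero.2 fun h' ↦ by
          rw [h'] at hw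
          exact absurd (mem_sphere.1 hw) (mem_ball.1 hz).ne
        have hzw : z - w ≠ 0 := by rwa [← neg_sub, neg_ne_zero]
        simp only [sub_zero, smul_eq_mul]
        field_simp
        ring
    rw [this, circleIntegral.integral_smul,
      circleIntegral.integral_sub (hint (mem_ball_self hρ)) (hint hz),
      circleIntegral.integral_sub_inv_of_mem_ball (mem_ball_self hρ),
      circleIntegral.integral_sub_inv_of_mem_ball hz, sub_self, smul_zero, smul_zero]

theorem integrableOn_inv_ball (R : ℝ) : IntegrableOn (fun w : ℂ ↦ w⁻¹) (ball 0 R) := by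
  have h1 : IntegrableOn (fun w : ℂ ↦ ‖w‖⁻¹) (ball 0 R) := by
    rw [integrableOn_fun_norm_addHaar volume (f := fun y ↦ y⁻¹)]
    refine (integrableOn_const (C := (1 : ℝ)) (by simp)).congr_fun (fun y hy ↦ ?_)
      measurableSet_Ioo
    have := hy.1.ne'
    simp [this]
  refine h1.mono' (by fun_prop) (ae_of_all _ fun w ↦ by simp)

theorem integrableOn_inv_sub_ball (z : ℂ) (R : ℝ) :
    IntegrableOn (fun w : ℂ ↦ (z - w)⁻¹) (ball 0 R) := by
  have h1 : IntegrableOn (fun w : ℂ ↦ (z - w)⁻¹) ((fun w ↦ z - w) ⁻¹' ball 0 (‖z‖ + R)) :=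
    ((Measure.measurePreserving_sub_left volume z).integrableOn_comp_preimage
      (MeasurableEquiv.subLeft z).measurableEmbedding).2 (integrableOn_inv_ball _)
  refine h1.mono_set fun w hw ↦ ?_
  rw [mem_ball_zero_iff] at hw
  rw [mem_preimage, mem_ball_zero_iff]
  exact (norm_sub_le z w).trans_lt (by linarith)

theorem setIntegral_ball_inv_sub {z : ℂ} {R : ℝ} (hz : ‖z‖ < R) :
    ∫ w in ball 0 R, (z - w)⁻¹ = Real.pi * (starRingEnd ℂ) z := by
  have hm : StronglyMeasurable ((ball (0 : ℂ) R).indicator fun w ↦ (z - w)⁻¹) :=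
    (by fun_prop : Measurable fun w : ℂ ↦ (z - w)⁻¹).stronglyMeasurable.indicator
      measurableSet_ball
  rw [← integral_indicator measurableSet_ball, integral_eq_integral_Ioi_smul_circleAverage hm
    ((integrableOn_inv_sub_ball z R).integrable_indicator measurableSet_ball)]
  have hae : ∀ᵐ ρ : ℝ, ρ ∈ Ioi (0 : ℝ) → (2 * Real.pi * ρ) •
      Real.circleAverage ((ball (0 : ℂ) R).indicator fun w ↦ (z - w)⁻¹) 0 ρ =
      (Ioc (0 : ℝ) ‖z‖).indicator (fun ρ : ℝ ↦ ((2 * Real.pi * ρ : ℝ) : ℂ) * z⁻¹) ρ := by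
    filter_upwards [compl_mem_ae_iff.2 (measure_singleton ‖z‖)] with ρ hρz hρ
    have hρ0 : 0 < ρ := hρ
    rcases lt_or_ge ρ R with hR | hR
    · have : Real.circleAverage ((ball (0 : ℂ) R).indicator fun w ↦ (z - w)⁻¹) 0 ρ =
          Real.circleAverage (fun w ↦ (z - w)⁻¹) 0 ρ := by
        refine Real.circleAverage_congr_sphere fun w hw ↦ indicator_of_mem ?_ _
        rw [mem_sphere_zero_iff_norm, abs_of_pos hρ0] at hw
        rwa [mem_ball_zero_iff, hw]
      rw [this]
      rcases lt_or_gt_of_ne (show ρ ≠ ‖z‖ from hρz) with h | h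
      · rw [circleAverage_inv_sub_of_lt hρ0.le h, indicator_of_mem (mem_Ioc.2 ⟨hρ0, h.le⟩),
          Complex.real_smul]
      · rw [circleAverage_inv_sub_of_gt h, indicator_of_notMem fun h' ↦ absurd h'.2 (not_le.2 h),
          smul_zero]
    · have : Real.circleAverage ((ball (0 : ℂ) R).indicator fun w ↦ (z - w)⁻¹) 0 ρ =
          Real.circleAverage (fun _ ↦ (0 : ℂ)) 0 ρ := by
        refine Real.circleAverage_congr_sphere fun w hw ↦ indicator_of_notMem ?_ _
        rw [mem_sphere_zero_iff_norm, abs_of_pos hρ0] at hw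
        rw [mem_ball_zero_iff, hw]
        exact not_lt.2 hR
      rw [this, Real.circleAverage_const, smul_zero,
        indicator_of_notMem fun h' ↦ absurd (h'.2.trans_lt hz) (not_lt.2 hR)]
  rw [setIntegral_congr_ae measurableSet_Ioi hae, setIntegral_indicator measurableSet_Ioc,
    inter_eq_right.2 Ioc_subset_Ioi_self, ← intervalIntegral.integral_of_le (norm_nonneg z),
    intervalIntegral.integral_mul_const, intervalIntegral.integral_ofReal,
    intervalIntegral.integral_const_mul, integral_id]
  rcases eq_or_ne z 0 with rfl | h0
  · simp
  · have := Complex.mul_conj' z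
    push_cast
    field_simp
    linear_combination -this

theorem differentiableOn_setIntegral_inv_sub {U s : Set ℂ} (hU : IsOpen U)
    (hs : MeasurableSet s) (hfin : volume s ≠ ⊤) (hUs : Disjoint U s) :
    DifferentiableOn ℂ (fun z ↦ ∫ w in s, (z - w)⁻¹) U := by
  intro z hz
  obtain ⟨ε, hε, hball⟩ := Metric.isOpen_iff.1 hU z hz
  have hle : ∀ᵐ w ∂volume.restrict s, ∀ x ∈ ball z (ε / 2), ε / 2 ≤ ‖x - w‖ := by
    filter_upwards [ae_restrict_mem hs] with w hw x hx
    have h1 : ε ≤ dist w z := by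
      by_contra! h
      exact disjoint_left.1 hUs (hball h) hw
    rw [← dist_eq_norm]
    have h2 := dist_triangle_left w z x
    rw [mem_ball] at hx
    linarith
  have : Fact (volume s < ⊤) := ⟨hfin.lt_top⟩
  refine (hasDerivAt_integral_of_dominated_loc_of_deriv_le
    (F := fun z w ↦ (z - w)⁻¹) (F' := fun z w ↦ -1 / (z - w) ^ 2) (s := ball z (ε / 2))
    (bound := fun _ ↦ 1 / (ε / 2) ^ 2) (ball_mem_nhds z (by positivity))
    (Eventually.of_forall fun x ↦ by fun_prop) ?_
    (by fun_prop : Measurable fun w ↦ -1 / (z - w) ^ 2).aestronglyMeasurable ?_ (integrable_const _)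
    ?_).2.differentiableAt.differentiableWithinAt
  · refine Integrable.mono' (integrable_const (1 / (ε / 2))) (by fun_prop) ?_
    filter_upwards [hle] with w hw
    have := hw z (mem_ball_self (by positivity))
    rw [norm_inv, ← one_div]
    gcongr
  · filter_upwards [hle] with w hw x hx
    have := hw x hx
    rw [norm_div, norm_neg, norm_one, norm_pow]
    gcongr
  · filter_upwards [hle] with w hw x hx
    have h0 : x - w ≠ 0 := norm_pos_iff.1 ((by positivity : (0 : ℝ) < ε / 2).trans_le (hw x hx))
    exact ((hasDerivAt_id x).sub_const w).inv h0

/-- Near a compact set of small area, `conj z` is uniformly close to a holomorphic function. -/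
theorem exists_differentiableOn_norm_sub_conj_le (R : ℝ) {τ : ℝ} (hτ : 0 < τ) :
    ∃ δ : ENNReal, 0 < δ ∧ ∀ K ⊆ ball (0 : ℂ) R, volume K < δ → ∃ U, IsOpen U ∧ K ⊆ U ∧
      ∃ f : ℂ → ℂ, DifferentiableOn ℂ f U ∧ ∀ z ∈ K, ‖f z - (starRingEnd ℂ) z‖ ≤ τ := by
  have hfin : ∫⁻ w : ℂ in ball 0 (2 * R), ‖w⁻¹‖ₑ ≠ ⊤ := (integrableOn_inv_ball (2 * R)).2.ne
  obtain ⟨δ, hδ, hsmall⟩ := exists_pos_setLIntegral_lt_of_measure_lt hfin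
    (ε := ENNReal.ofReal (Real.pi * τ)) (by simpa using mul_pos Real.pi_pos hτ)
  refine ⟨δ, hδ, fun K hK hKδ ↦ ?_⟩
  obtain ⟨U, hKU, hU, hUδ⟩ := K.exists_isOpen_lt_of_lt δ hKδ
  refine ⟨U, hU, hKU, fun z ↦ (Real.pi : ℂ)⁻¹ * ∫ w in ball 0 R \ U, (z - w)⁻¹,
    (differentiableOn_setIntegral_inv_sub hU (measurableSet_ball.diff hU.measurableSet)
      (measure_mono sdiff_subset |>.trans_lt measure_ball_lt_top).ne
      disjoint_sdiff_right).const_mul _, fun z hz ↦ ?_⟩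
  have hzR := mem_ball_zero_iff.1 (hK hz)
  have hsplit := integral_inter_add_sdiff hU.measurableSet (integrableOn_inv_sub_ball z R)
  rw [setIntegral_ball_inv_sub hzR] at hsplit
  have hpi : (Real.pi : ℂ) ≠ 0 := by exact_mod_cast Real.pi_ne_zero
  have heq : (Real.pi : ℂ)⁻¹ * (∫ w in ball 0 R \ U, (z - w)⁻¹) - (starRingEnd ℂ) z =
      -((Real.pi : ℂ)⁻¹ * ∫ w in ball 0 R ∩ U, (z - w)⁻¹) := by
    linear_combination (Real.pi : ℂ)⁻¹ * hsplit + (starRingEnd ℂ) z * inv_mul_cancel₀ hpi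
  have hbd : ‖∫ w in ball 0 R ∩ U, (z - w)⁻¹‖ₑ ≤ ENNReal.ofReal (Real.pi * τ) := by
    refine (enorm_integral_le_lintegral_enorm _).trans ?_
    have hmp := Measure.measurePreserving_sub_left (volume : Measure ℂ) z
    set S : Set ℂ := (fun w ↦ z - w) '' (ball 0 R ∩ U) with hS
    have hemb := (MeasurableEquiv.subLeft z).measurableEmbedding
    have hpre : (fun w ↦ z - w) ⁻¹' S = ball 0 R ∩ U :=
      preimage_image_eq _ (sub_right_injective)
    have hSm : volume S < δ := by
      rw [← hmp.measure_preimage_emb hemb, hpre]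
      exact (measure_mono inter_subset_right).trans_lt hUδ
    have hSball : S ⊆ ball 0 (2 * R) := by
      rintro _ ⟨w, hw, rfl⟩
      have := mem_ball_zero_iff.1 hw.1
      rw [mem_ball_zero_iff]
      exact (norm_sub_le z w).trans_lt (by linarith)
    have h1 := hmp.setLIntegral_comp_preimage_emb hemb (fun w ↦ ‖w⁻¹‖ₑ) S
    rw [hpre] at h1
    rw [h1]
    have h2 := hsmall S ((Measure.restrict_apply_le _ _).trans_lt hSm)
    rw [Measure.restrict_restrict_of_subset hSball] at h2
    exact h2.le
  rw [heq, norm_neg, norm_mul, norm_inv, Complex.norm_real, Real.norm_of_nonneg Real.pi_pos.le,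
    inv_mul_le_iff₀ Real.pi_pos]
  rw [← ofReal_norm] at hbd
  exact (ENNReal.ofReal_le_ofReal_iff (by positivity)).1 hbd

theorem IsAnalyticSubsetOf.mem_of_mem_closure {k : ℕ} {W A : Set (Fin k → ℂ)}
    (hA : IsAnalyticSubsetOf W A) {y : Fin k → ℂ} (hy : y ∈ W) (hcl : y ∈ closure A) : y ∈ A := by
  obtain ⟨U, hU, hyU, -, N, g, hg, hAU⟩ := hA.2 y hy
  refine (hAU.superset ⟨hyU, fun i ↦ ?_⟩).1
  have hcl' : y ∈ closure (A ∩ U) := by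
    rw [inter_comm]
    exact hU.inter_closure ⟨hyU, hcl⟩
  have hmaps : MapsTo (g i) (A ∩ U) {0} := fun w hw ↦ (hAU.subset hw).2 i
  have := (((hg i).continuousOn y hyU).mono inter_subset_right).mem_closure hcl' hmaps
  simpa using this

theorem mem_of_mem_closure_coordinate_slice {n : ℕ} {Ω A : Set (Fin (n + 1) → ℂ)}
    {i : Fin (n + 1)} {c : ℂ}
    (h : A ∩ {z | z i = c} = ∅ ∨
      IsAnalyticSubsetOf ((fun y : Fin n → ℂ => i.insertNth c y) ⁻¹' Ω)
        ((fun y : Fin n → ℂ => i.insertNth c y) ⁻¹' A))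
    {z : Fin (n + 1) → ℂ} (hz : z ∈ Ω) (hcl : z ∈ closure (A ∩ {z | z i = c})) : z ∈ A := by
  rcases h with h | h
  · simp [h] at hcl
  have hzc : z i = c :=
    closure_minimal inter_subset_right (isClosed_eq (continuous_apply i) continuous_const) hcl
  have hins : ∀ w : Fin (n + 1) → ℂ, w i = c → i.insertNth c (i.removeNth w) = w := by
    rintro w rfl
    exact Fin.insertNth_self_removeNth i w
  have hcont : Continuous fun w : Fin (n + 1) → ℂ ↦ i.removeNth w :=
    continuous_pi fun k ↦ continuous_apply (i.succAbove k)
  have hmem := h.mem_of_mem_closure (y := i.removeNth z) (by simpa [hins z hzc] using hz)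
    (map_mem_closure hcont hcl fun w hw ↦ by simpa [hins w hw.2] using hw.1)
  simpa [hins z hzc] using hmem

theorem eventually_measure_lt_of_forall_eventually_notMem {α : Type*} [MeasurableSpace α]
    {μ : Measure α} {K : ℕ → Set α} {B : Set α} (hK : ∀ j, MeasurableSet (K j))
    (hB : MeasurableSet B) (hBfin : μ B ≠ ⊤) (hKB : ∀ j, K j ⊆ B)
    (h : ∀ x, ∀ᶠ j in atTop, x ∉ K j) {δ : ENNReal} (hδ : 0 < δ) :
    ∀ᶠ j in atTop, μ (K j) < δ := by
  have := tendsto_measure_of_tendsto_indicator (μ := μ) (A := ∅) atTop hK hB hBfin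
    (Eventually.of_forall hKB) (fun x ↦ by simpa using h x)
  rw [measure_empty] at this
  exact this.eventually (gt_mem_nhds hδ)

theorem re_neg_sum_mul_add_half_sum_norm_sq_neg {n : ℕ} {x F : Fin n → ℂ} {ε τ : ℝ}
    (hε : 0 < ε) (hτ : 0 < τ) (hετ : 64 * (n + 1) * τ = ε) (hx : ∀ k, ‖x k‖ ≤ 2 * ε)
    (hF : ∀ k, ‖F k - (starRingEnd ℂ) (x k)‖ ≤ 2 * τ) {k : Fin n} (hk : ε / 2 ≤ ‖x k‖) :
    (-∑ k, x k * F k).re + 1 / 2 * ∑ k, ‖x k‖ ^ 2 < 0 := by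
  have h1 : ∀ k, -(x k * F k).re + 1 / 2 * ‖x k‖ ^ 2 ≤ 4 * ε * τ - 1 / 2 * ‖x k‖ ^ 2 := fun k ↦ by
    have h2 : x k * F k = x k * (F k - (starRingEnd ℂ) (x k)) + ((‖x k‖ ^ 2 : ℝ) : ℂ) := by
      push_cast
      rw [← Complex.mul_conj']
      ring
    have h3 := (abs_le.1 (Complex.abs_re_le_norm (x k * (F k - (starRingEnd ℂ) (x k))))).1
    rw [norm_mul] at h3
    rw [h2, Complex.add_re, Complex.ofReal_re]
    have h4 : ‖x k‖ * ‖F k - (starRingEnd ℂ) (x k)‖ ≤ 2 * ε * (2 * τ) := by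
      gcongr
      exacts [hx k, hF k]
    linarith
  have h5 := Finset.sum_le_sum fun k (_ : k ∈ Finset.univ) ↦ h1 k
  rw [Finset.sum_add_distrib, Finset.sum_sub_distrib, ← Finset.mul_sum] at h5
  simp only [Finset.sum_neg_distrib, Finset.sum_const, Finset.card_univ, Fintype.card_fin,
    nsmul_eq_mul] at h5
  have h6 : ‖x k‖ ^ 2 ≤ ∑ k, ‖x k‖ ^ 2 :=
    Finset.single_le_sum (f := fun k ↦ ‖x k‖ ^ 2) (fun _ _ ↦ sq_nonneg _) (Finset.mem_univ k)
  have h7 := pow_le_pow_left₀ (by positivity) hk 2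
  rw [Complex.neg_re, Complex.re_sum]
  have h8 : (n : ℝ) * (4 * ε * τ) ≤ ε ^ 2 / 16 := by
    have : 0 ≤ ε * τ := by positivity
    rw [← hετ] at this ⊢
    nlinarith
  nlinarith [pow_pos hε 2]

theorem mem_of_mem_closure_of_forall_slice {n r : ℕ} (hr : 1 ≤ r)
    {Ω A : Set (Fin (n + 1) → ℂ)} (hΩ : IsOpen Ω)
    (h : ∀ (i : Fin (n + 1)) (c : ℂ),
      A ∩ {z | z i = c} = ∅ ∨
      (IsAnalyticSubsetOf ((fun y : Fin n → ℂ => i.insertNth c y) ⁻¹' Ω)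
          ((fun y : Fin n → ℂ => i.insertNth c y) ⁻¹' A) ∧
        HasPureDim n ((fun y : Fin n → ℂ => i.insertNth c y) ⁻¹' A) r))
    {p : Fin (n + 1) → ℂ} (hpΩ : p ∈ Ω) (hcl : p ∈ closure A) : p ∈ A := by
  by_contra hpA
  have hslice : ∀ i c, ∀ z ∈ Ω, z ∈ closure (A ∩ {z | z i = c}) → z ∈ A := fun i c z hz ↦
    mem_of_mem_closure_coordinate_slice ((h i c).imp_right And.left) hz
  obtain ⟨ε, hε, hball⟩ := nhds_basis_closedBall.mem_iff.1 (inter_mem (hΩ.mem_nhds hpΩ)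
    (isClosed_closure.isOpen_compl.mem_nhds fun hp ↦ hpA (hslice 0 (p 0) p hpΩ hp)))
  obtain ⟨a, haA, ha⟩ := mem_closure_iff_seq_limit.1 hcl
  set C : ℕ → Set (Fin (n + 1) → ℂ) := fun j ↦ (A ∩ {z | z 0 = a j 0}) ∩ closedBall p ε with hC
  have hCc : ∀ j, IsCompact (C j) := fun j ↦ by
    refine (isCompact_closedBall p ε).of_isClosed_subset (isClosed_of_closure_subset ?_)
      inter_subset_right
    intro z hz
    have hzb : z ∈ closedBall p ε := closure_minimal inter_subset_right isClosed_closedBall hz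
    have hzs := closure_mono inter_subset_left hz
    exact ⟨⟨hslice 0 _ z (hball hzb).1 hzs, closure_minimal inter_subset_right
      (isClosed_eq (continuous_apply 0) continuous_const) hzs⟩, hzb⟩
  have hev : ∀ (k : Fin n) (x : ℂ), ∀ᶠ j in atTop, x ∉ (fun z ↦ z k.succ) '' C j := by
    intro k x
    by_contra hfr
    simp only [not_eventually, not_not] at hfr
    obtain ⟨φ, hφ, hx⟩ := extraction_of_frequently_atTop hfr
    choose z hzC hzx using hx
    obtain ⟨z₀, hz₀, ψ, hψ, hlim⟩ := (isCompact_closedBall p ε).tendsto_subseq fun m ↦ (hzC m).2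
    have hz₀A : z₀ ∈ A := hslice k.succ x z₀ (hball hz₀).1
      (mem_closure_of_tendsto hlim (Eventually.of_forall fun m ↦ ⟨(hzC _).1.1, hzx _⟩))
    have h1 : Tendsto (fun m ↦ z (ψ m) 0) atTop (𝓝 (z₀ 0)) :=
      ((continuous_apply 0).tendsto z₀).comp hlim
    have h2 : Tendsto (fun m ↦ z (ψ m) 0) atTop (𝓝 (p 0)) := by
      have := ((continuous_apply 0).tendsto p).comp
        (ha.comp (hφ.tendsto_atTop.comp hψ.tendsto_atTop))
      refine this.congr fun m ↦ ?_
      exact ((hzC (ψ m)).1.2).symm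
    exact (hball hz₀).2 (subset_closure ⟨hz₀A, tendsto_nhds_unique h1 h2⟩)
  set τ : ℝ := ε / (64 * (n + 1)) with hτdef
  have hτ : 0 < τ := by positivity
  obtain ⟨δ, hδ, happrox⟩ := exists_differentiableOn_norm_sub_conj_le (‖p‖ + ε + 1) hτ
  have hKB : ∀ (k : Fin n) j, (fun z ↦ z k.succ) '' C j ⊆ ball 0 (‖p‖ + ε + 1) := by
    rintro k j _ ⟨z, hz, rfl⟩
    rw [mem_ball_zero_iff]
    have h1 := mem_closedBall_iff_norm.1 hz.2
    have h2 := norm_le_pi_norm z k.succ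
    have h3 := norm_le_norm_add_norm_sub' z p
    linarith
  have hvol : ∀ᶠ j in atTop, ∀ k : Fin n, volume ((fun z ↦ z k.succ) '' C j) < δ :=
    eventually_all.2 fun k ↦ eventually_measure_lt_of_forall_eventually_notMem
      (fun j ↦ ((hCc j).image (continuous_apply k.succ)).measurableSet) measurableSet_ball
      measure_ball_lt_top.ne (hKB k) (hev k) hδ
  obtain ⟨j, hvj, haj⟩ := (hvol.and (ha.eventually (ball_mem_nhds p (half_pos hε)))).exists
  have hajp : ∀ i, ‖a j i - p i‖ ≤ ε / 2 := fun i ↦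
    (norm_le_pi_norm (a j - p) i).trans (mem_ball_iff_norm.1 haj).le
  have hajC : a j ∈ C j :=
    ⟨⟨haA j, rfl⟩, ball_subset_closedBall (ball_subset_ball (by linarith) haj)⟩
  choose U hU hKU f hf hfle using fun k ↦ happrox _ (hKB k j) (hvj k)
  set b : Fin n → ℂ := Fin.tail (a j) with hb
  set G : (Fin n → ℂ) → ℂ := fun y ↦ -∑ k, (y k - b k) * (f k (y k) - f k (b k)) with hG
  set u : (Fin n → ℂ) → ℝ := fun y ↦ (G y).re + 1 / 2 * ∑ k, ‖y k - b k‖ ^ 2 with hu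
  set U' : Set (Fin n → ℂ) := ⋂ k, (fun y ↦ y k) ⁻¹' U k with hU'
  have hU'o : IsOpen U' := isOpen_iInter_of_finite fun k ↦ (hU k).preimage (continuous_apply k)
  have hGd : DifferentiableOn ℂ G U' := by
    refine (DifferentiableOn.fun_sum fun k _ ↦ ?_).neg
    have h1 : DifferentiableOn ℂ (fun y : Fin n → ℂ ↦ f k (y k)) U' :=
      (hf k).comp (by fun_prop : Differentiable ℂ fun y : Fin n → ℂ ↦ y k).differentiableOn
        fun y hy ↦ mem_iInter.1 hy k
    exact (by fun_prop : Differentiable ℂ fun y : Fin n → ℂ ↦ y k - b k).differentiableOn.mul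
      (h1.sub_const _)
  have htail : MapsTo Fin.tail (C j) U' := fun z hz ↦ mem_iInter.2 fun k ↦ hKU k ⟨z, hz, rfl⟩
  have huc : ContinuousOn u U' := by
    have := hGd.continuousOn
    fun_prop
  have htc : Continuous fun z : Fin (n + 1) → ℂ ↦ Fin.tail z :=
    continuous_pi fun k ↦ continuous_apply k.succ
  obtain ⟨z, hzC, hzmax⟩ := (hCc j).exists_isMaxOn ⟨_, hajC⟩ (huc.comp htc.continuousOn htail)
  set y : Fin n → ℂ := Fin.tail z with hy
  have hub : u b = 0 := by simp [hu, hG]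
  have huy : 0 ≤ u y := hub ▸ hzmax hajC
  have hzp : ∀ i, ‖z i - p i‖ ≤ ε := fun i ↦
    (norm_le_pi_norm (z - p) i).trans (mem_closedBall_iff_norm.1 hzC.2)
  have hyball : y ∈ ball (Fin.tail p) ε := by
    rw [mem_ball_iff_norm]
    by_contra! hle
    obtain ⟨k, hk⟩ := exists_le_norm_sub_of_le_norm_sub hε hle
    refine absurd huy (not_le.2 (re_neg_sum_mul_add_half_sum_norm_sq_neg (τ := τ) (k := k) hε hτ
      (by rw [hτdef]; field_simp) (fun i ↦ ?_) (fun i ↦ ?_) ?_))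
    · have h1 := norm_sub_le_norm_sub_add_norm_sub (z i.succ) (p i.succ) (a j i.succ)
      rw [norm_sub_rev (p i.succ)] at h1
      have h2 := hajp i.succ
      have h3 := hzp i.succ
      change ‖z i.succ - a j i.succ‖ ≤ _
      linarith
    · have h1 := hfle i (y i) ⟨z, hzC, rfl⟩
      have h2 := hfle i (b i) ⟨a j, hajC, rfl⟩
      rw [map_sub, sub_sub_sub_comm]
      exact (norm_sub_le _ _).trans (by linarith)
    · have h1 := norm_sub_le_norm_sub_add_norm_sub (z k.succ) (a j k.succ) (p k.succ)
      have h2 := hajp k.succ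
      change ε ≤ ‖z k.succ - p k.succ‖ at hk
      change _ ≤ ‖z k.succ - a j k.succ‖
      linarith
  have hins : ∀ w : Fin n → ℂ,
      (0 : Fin (n + 1)).insertNth (a j 0) w = (Fin.cons (a j 0) w : Fin (n + 1) → ℂ) :=
    fun w ↦ Fin.insertNth_zero' _ _
  have hzy : (Fin.cons (a j 0) y : Fin (n + 1) → ℂ) = z := by
    rw [← hzC.1.2]
    exact Fin.cons_self_tail z
  obtain ⟨han, hdim⟩ := (h 0 (a j 0)).resolve_left (nonempty_iff_ne_empty.1 ⟨a j, haA j, rfl⟩)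
  set V : Set (Fin n → ℂ) := (fun w : Fin n → ℂ => (0 : Fin (n + 1)).insertNth (a j 0) w) ⁻¹' A
    with hV
  have hyV : y ∈ V := by
    rw [hV, mem_preimage, hins, hzy]
    exact hzC.1.1
  obtain ⟨W, hW, hyW, -, N, g, hg, hVW⟩ := han.2 y (han.1 hyV)
  refine not_isLocalMaxOn_re_add_sum_norm_sq (hW.inter hU'o)
    (fun i ↦ (hg i).mono inter_subset_left) ?_ (fun q hq ↦ accPt_of_hasPureDim hr hdim hq)
    (hGd.mono inter_subset_right) one_half_pos b hyV ⟨hyW, htail hzC⟩ ?_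
  · rw [← inter_assoc, hVW]
    ext w
    simp only [mem_inter_iff, Set.mem_ofPred_eq]
    tauto
  · filter_upwards [self_mem_nhdsWithin, mem_nhdsWithin_of_mem_nhds (isOpen_ball.mem_nhds hyball)]
      with w hwV hwb
    rw [hV, mem_preimage, hins] at hwV
    have hwC : (Fin.cons (a j 0) w : Fin (n + 1) → ℂ) ∈ C j := by
      refine ⟨⟨hwV, Fin.cons_zero _ _⟩, ?_⟩
      rw [mem_closedBall_iff_norm, pi_norm_le_iff_of_nonneg hε.le]
      refine Fin.cases ?_ fun k ↦ ?_
      · simpa using (hajp 0).trans (by linarith)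
      · simpa [Fin.tail] using
          (norm_le_pi_norm (w - Fin.tail p) k).trans (mem_ball_iff_norm.1 hwb).le
    have := hzmax hwC
    simpa only [Set.mem_ofPred_eq, Function.comp_apply, Fin.tail_cons] using this

end

/-- **Theorem (Alexander–Taylor–Ullman).** Let `Ω ⊆ ℂ^{n+1}` be open, `r ≥ 1`, and let
`A ⊆ Ω` be such that for every coordinate `n`-plane `Πⁿ` (given by fixing the `i`-th
coordinate to the value `c`, and identified with `ℂⁿ` via `Fin.insertNth`), the
intersection `A ∩ Πⁿ` is either empty or an analytic subset of `Ω ∩ Πⁿ` of pure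
dimension `r`.  Then `A` is closed in `Ω`. -/
theorem atu_closedness (n r : ℕ) (hr : 1 ≤ r)
    (Ω : Set (Fin (n + 1) → ℂ)) (hΩ : IsOpen Ω)
    (A : Set (Fin (n + 1) → ℂ)) (hA : A ⊆ Ω)
    (h : ∀ (i : Fin (n + 1)) (c : ℂ),
      A ∩ {z | z i = c} = ∅ ∨
      (IsAnalyticSubsetOf ((fun y : Fin n → ℂ => i.insertNth c y) ⁻¹' Ω)
          ((fun y : Fin n → ℂ => i.insertNth c y) ⁻¹' A) ∧
        HasPureDim n ((fun y : Fin n → ℂ => i.insertNth c y) ⁻¹' A) r)) :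
    IsClosed (Subtype.val ⁻¹' A : Set ↥Ω) := by
  refine isClosed_of_closure_subset fun p hp ↦ ?_
  exact mem_of_mem_closure_of_forall_slice hr hΩ h p.2
    (map_mem_closure continuous_subtype_val hp fun _ hx ↦ hx)
end
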